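/- arXiv:1204.0870 — 14 statements merged into one kernel-verified Lean document; each statement's English description precedes it below -/
import Mathlib

section
/- Let F be a nonempty finite set, X a nonempty set, ℓ : F × X → ℝ a loss function, and T a positive integer. For each 0 ≤ t ≤ T let Rel_t assign a real number to every sequence (x_1,…,x_t) ∈ X^t. Let x_1,…,x_T ∈ X and let q_1,…,q_T be probability vectors on F (each q_t may depend arbitrarily on x_1,…,x_{t−1}). Assume: (a) for every 1 ≤ t ≤ T and every x ∈ X, Σ_{f∈F} q_t(f)·ℓ(f,x) + Rel_t(x_1,…,x_{t−1},x) ≤ Rel_{t−1}(x_1,…,x_{t−1}); and (b) Rel_T(x_1,…,x_T) ≥ − min_{f∈F} Σ_{t=1}^T ℓ(f,x_t). Then Σ_{t=1}^T Σ_{f∈F} q_t(f)·ℓ(f,x_t) − min_{f∈F} Σ_{t=1}^T ℓ(f,x_t) ≤ Rel_0(), the value of the relaxation on the empty sequence. -/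
/-- Appending `x t` to the first `t` terms of a sequence gives its first `t + 1` terms. -/
theorem Fin.snoc_val_comp {X : Type*} (x : ℕ → X) (t : ℕ) :
    (Fin.snoc (fun i : Fin t => x i.val) (x t) : Fin (t + 1) → X) = fun i => x i.val := by
  funext i
  refine Fin.lastCases ?_ (fun j => ?_) i <;> simp

/-- For any admissible relaxation and any strategies admissible with
respect to it, the cumulative expected loss minus the loss of the best fixed
decision is bounded by the relaxation at the empty history (Proposition 1). -/
theorem regret_le_relaxation_of_admissible
    {F X : Type*} [Fintype F] [Nonempty F] [Nonempty X]
    (ℓ : F → X → ℝ) (T : ℕ) (hT : 0 < T)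
    (Rel : (t : ℕ) → (Fin t → X) → ℝ)
    (x : ℕ → X) (q : ℕ → F → ℝ)
    (hq_nonneg : ∀ t, t < T → ∀ f, 0 ≤ q t f)
    (hq_sum : ∀ t, t < T → ∑ f, q t f = 1)
    (ha : ∀ t, t < T → ∀ y : X,
      (∑ f, q t f * ℓ f y) + Rel (t + 1) (Fin.snoc (fun i : Fin t => x i.val) y)
        ≤ Rel t (fun i : Fin t => x i.val))
    (hb : Rel T (fun i : Fin T => x i.val) ≥
      - Finset.univ.inf' Finset.univ_nonempty
          (fun f : F => ∑ t ∈ Finset.range T, ℓ f (x t))) :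
    (∑ t ∈ Finset.range T, ∑ f, q t f * ℓ f (x t))
        - Finset.univ.inf' Finset.univ_nonempty
            (fun f : F => ∑ t ∈ Finset.range T, ℓ f (x t))
      ≤ Rel 0 (fun i : Fin 0 => x i.val) := by
  have telescope : ∀ n ≤ T,
      (∑ t ∈ Finset.range n, ∑ f, q t f * ℓ f (x t)) + Rel n (fun i : Fin n => x i.val)
        ≤ Rel 0 (fun i : Fin 0 => x i.val) := by
    intro n
    induction n with
    | zero => simp
    | succ n ih =>
      intro hn
      have step := ha n hn (x n)
      rw [Fin.snoc_val_comp] at step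
      rw [Finset.sum_range_succ]
      linarith [ih (Nat.le_of_succ_le hn)]
  linarith [telescope T le_rfl]
end

section
/- Let F and X be nonempty finite sets, ℓ : F × X → ℝ a loss function, and T a positive integer. For 0 ≤ t ≤ T and x_1,…,x_t ∈ X define the conditional sequential Rademacher complexity R_T(F | x_1,…,x_t) = max over X-valued trees z of depth T−t of 2^{−(T−t)} Σ_{ε∈{−1,1}^{T−t}} max_{f∈F} [ 2 Σ_{s=1}^{T−t} ε_s ℓ(f, z_s(ε)) − Σ_{s=1}^{t} ℓ(f, x_s) ]. Then for every 1 ≤ t ≤ T and every x_1,…,x_{t−1} ∈ X there exists a probability vector q on F such that for every x ∈ X: Σ_{f∈F} q(f)·ℓ(f,x) + R_T(F | x_1,…,x_{t−1},x) ≤ R_T(F | x_1,…,x_{t−1}). (Moreover R_T(F | x_1,…,x_T) = − min_{f∈F} Σ_{t=1}^T ℓ(f,x_t), so the conditional sequential Rademacher complexity is an admissible relaxation.) -/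
/-- The conditional sequential Rademacher complexity
`R_T(F | x_1, …, x_t)`: the maximum over `X`-valued trees of depth `T - t` of the
average over sign sequences `ε ∈ {−1,1}^{T−t}` of
`max_{f∈F} [ 2 Σ_s ε_s ℓ(f, z_s(ε)) − Σ_{s≤t} ℓ(f, x_s) ]`. -/
noncomputable def condSeqRad {F X : Type*} [Fintype F] [Nonempty F] [Fintype X] [Nonempty X]
    (ℓ : F → X → ℝ) (T t : ℕ) (x : Fin t → X) : ℝ :=
  Finset.univ.sup' Finset.univ_nonempty
    (fun z : (s : Fin (T - t)) → (Fin s.val → Bool) → X =>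
      (2 : ℝ)⁻¹ ^ (T - t) *
        ∑ ε : Fin (T - t) → Bool,
          Finset.univ.sup' Finset.univ_nonempty (fun f : F =>
            2 * (∑ s : Fin (T - t),
              (if ε s then (1 : ℝ) else -1) *
                ℓ f (z s (fun i => ε (Fin.castLT i (lt_trans i.isLt s.isLt)))))
              - ∑ s : Fin t, ℓ f (x s)))

/-- A finite zero-sum matrix game has a pair of optimal mixed strategies. -/
theorem exists_mixed_saddle {F X : Type*} [Fintype F] [Nonempty F] [Fintype X] [Nonempty X]
    (A : Matrix F X ℝ) :
    ∃ q ∈ stdSimplex ℝ F, ∃ p ∈ stdSimplex ℝ X,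
      ∀ f y, ∑ g, q g * A g y ≤ ∑ w, p w * A f w := by
  classical
  have hq : ∀ p : X → ℝ, IsLinearMap ℝ fun q : F → ℝ => q ⬝ᵥ A.mulVec p := fun p =>
    ⟨fun u v => add_dotProduct u v _, fun c u => smul_dotProduct c u _⟩
  have hp : ∀ q : F → ℝ, IsLinearMap ℝ fun p : X → ℝ => q ⬝ᵥ A.mulVec p := fun q =>
    ⟨fun u v => by rw [Matrix.mulVec_add, dotProduct_add],
      fun c u => by rw [Matrix.mulVec_smul, dotProduct_smul]⟩
  obtain ⟨q, hqS, p, hpS, h⟩ := Sion.exists_isSaddlePointOn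
    (X := stdSimplex ℝ F) (Y := stdSimplex ℝ X) (f := fun q p => q ⬝ᵥ A.mulVec p)
    ⟨_, single_mem_stdSimplex ℝ (Classical.arbitrary F)⟩ (convex_stdSimplex ℝ F)
    (isCompact_stdSimplex ℝ F)
    (fun p _ => ((hq p).mk' _).continuous_of_finiteDimensional.lowerSemicontinuous
      |>.lowerSemicontinuousOn _)
    (fun p _ => (((hq p).mk' _).convexOn (convex_stdSimplex ℝ F)).quasiconvexOn)
    (convex_stdSimplex ℝ X) ⟨_, single_mem_stdSimplex ℝ (Classical.arbitrary X)⟩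
    (isCompact_stdSimplex ℝ X)
    (fun q _ => ((hp q).mk' _).continuous_of_finiteDimensional.upperSemicontinuous
      |>.upperSemicontinuousOn _)
    (fun q _ => (((hp q).mk' _).concaveOn (convex_stdSimplex ℝ X)).quasiconcaveOn)
  refine ⟨q, hqS, p, hpS, fun f y => ?_⟩
  have h' := h _ (single_mem_stdSimplex ℝ f) _ (single_mem_stdSimplex ℝ y)
  beta_reduce at h'
  rw [Matrix.mulVec_single_one, single_one_dotProduct] at h'
  simpa only [dotProduct, Matrix.mulVec, Matrix.col_apply, mul_comm (p _)] using h'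

section SeqRad

variable {F X : Type*}

/-- The signed sum of losses of `f` along the path `ε` of the tree `z`. -/
def pathSum (ℓ : F → X → ℝ) {n : ℕ} (z : (s : Fin n) → (Fin s.val → Bool) → X)
    (ε : Fin n → Bool) (f : F) : ℝ :=
  ∑ s : Fin n, (if ε s then (1 : ℝ) else -1) *
    ℓ f (z s (fun i => ε (Fin.castLT i (lt_trans i.isLt s.isLt))))

/-- The tree with root `y` and subtrees `z true`, `z false`. -/
def joinTree {n : ℕ} (y : X) (z : Bool → (s : Fin n) → (Fin s.val → Bool) → X) :
    (s : Fin (n + 1)) → (Fin s.val → Bool) → X :=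
  Fin.cases (fun _ => y) fun s η => z (η ⟨0, s.val.succ_pos⟩) s (fun i => η i.succ)

theorem pathSum_joinTree (ℓ : F → X → ℝ) {n : ℕ} (y : X)
    (z : Bool → (s : Fin n) → (Fin s.val → Bool) → X) (c : Bool) (ε : Fin n → Bool) (f : F) :
    pathSum ℓ (joinTree y z) (Fin.cons c ε : Fin (n + 1) → Bool) f =
      (if c then (1 : ℝ) else -1) * ℓ f y + pathSum ℓ (z c) ε f := by
  rw [pathSum, Fin.sum_univ_succ]
  rfl

variable [Fintype F] [Nonempty F]

/-- The average over paths of the tree `z` of the regret against cumulative losses `b`. -/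
noncomputable def treeValue (ℓ : F → X → ℝ) (n : ℕ) (b : F → ℝ)
    (z : (s : Fin n) → (Fin s.val → Bool) → X) : ℝ :=
  (2 : ℝ)⁻¹ ^ n * ∑ ε : Fin n → Bool,
    Finset.univ.sup' Finset.univ_nonempty (fun f : F => 2 * pathSum ℓ z ε f - b f)

/-- The maximum of `treeValue` over the trees of depth `n`. -/
noncomputable def seqRad [Fintype X] [Nonempty X] (ℓ : F → X → ℝ) (n : ℕ) (b : F → ℝ) : ℝ :=
  Finset.univ.sup' Finset.univ_nonempty (treeValue ℓ n b)

theorem condSeqRad_eq_seqRad [Fintype X] [Nonempty X] (ℓ : F → X → ℝ) (T t : ℕ) (x : Fin t → X) :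
    condSeqRad ℓ T t x = seqRad ℓ (T - t) (fun f => ∑ s, ℓ f (x s)) := rfl

theorem treeValue_add_le (ℓ : F → X → ℝ) (n : ℕ) {b b' : F → ℝ} {r : ℝ}
    (h : ∀ f, b' f + r ≤ b f) (z : (s : Fin n) → (Fin s.val → Bool) → X) :
    treeValue ℓ n b z + r ≤ treeValue ℓ n b' z := by
  have hr : r = (2 : ℝ)⁻¹ ^ n * ∑ _ε : Fin n → Bool, r := by
    simp
  rw [hr, treeValue, treeValue, ← mul_add, ← Finset.sum_add_distrib]
  gcongr with ε
  rw [← le_sub_iff_add_le]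
  refine Finset.sup'_le _ _ fun f _ => ?_
  have := Finset.le_sup' (fun f : F => 2 * pathSum ℓ z ε f - b' f) (Finset.mem_univ f)
  linarith [h f]

theorem convexOn_treeValue (ℓ : F → X → ℝ) (n : ℕ)
    (z : (s : Fin n) → (Fin s.val → Bool) → X) :
    ConvexOn ℝ Set.univ (fun b => treeValue ℓ n b z) := by
  refine ⟨convex_univ, fun b _ b' _ u v hu hv huv => ?_⟩
  simp only [treeValue, smul_eq_mul]
  rw [mul_left_comm u, mul_left_comm v, ← mul_add, Finset.mul_sum _ _ u, Finset.mul_sum _ _ v,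
    ← Finset.sum_add_distrib]
  gcongr with ε
  refine Finset.sup'_le _ _ fun f _ => ?_
  have h := Finset.le_sup' (fun f : F => 2 * pathSum ℓ z ε f - b f) (Finset.mem_univ f)
  have h' := Finset.le_sup' (fun f : F => 2 * pathSum ℓ z ε f - b' f) (Finset.mem_univ f)
  refine le_trans (le_of_eq ?_)
    (add_le_add (mul_le_mul_of_nonneg_left h hu) (mul_le_mul_of_nonneg_left h' hv))
  simp only [Pi.add_apply, Pi.smul_apply, smul_eq_mul]
  linear_combination (-2 * pathSum ℓ z ε f) * huv

theorem treeValue_joinTree (ℓ : F → X → ℝ) {n : ℕ} (b : F → ℝ) (y : X)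
    (z : Bool → (s : Fin n) → (Fin s.val → Bool) → X) :
    treeValue ℓ (n + 1) b (joinTree y z) =
      2⁻¹ * treeValue ℓ n (fun f => b f - 2 * ℓ f y) (z true) +
        2⁻¹ * treeValue ℓ n (fun f => b f + 2 * ℓ f y) (z false) := by
  simp only [treeValue]
  rw [← (Fin.consEquiv fun _ : Fin (n + 1) => Bool).sum_comp, Fintype.sum_prod_type,
    Fintype.sum_bool]
  have h₁ : ∀ l r c : ℝ, 2 * (1 * l + r) - c = 2 * r - (c - 2 * l) := fun l r c => by ring
  have h₂ : ∀ l r c : ℝ, 2 * (-1 * l + r) - c = 2 * r - (c + 2 * l) := fun l r c => by ring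
  simp only [Fin.consEquiv, Equiv.coe_fn_mk, pathSum_joinTree, if_true, Bool.false_eq_true,
    if_false, h₁, h₂]
  rw [pow_succ', mul_add, mul_assoc, mul_assoc]

variable [Fintype X] [Nonempty X]

theorem seqRad_add_le (ℓ : F → X → ℝ) (n : ℕ) {b b' : F → ℝ} {r : ℝ}
    (h : ∀ f, b' f + r ≤ b f) : seqRad ℓ n b + r ≤ seqRad ℓ n b' := by
  rw [← le_sub_iff_add_le]
  refine Finset.sup'_le _ _ fun z _ => le_sub_iff_add_le.2 ?_
  exact (treeValue_add_le ℓ n h z).trans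
    (Finset.le_sup' (treeValue ℓ n b') (Finset.mem_univ z))

theorem convexOn_seqRad (ℓ : F → X → ℝ) (n : ℕ) : ConvexOn ℝ Set.univ (seqRad ℓ n) := by
  refine ⟨convex_univ, fun b hb b' hb' u v hu hv huv => Finset.sup'_le _ _ fun z _ => ?_⟩
  refine ((convexOn_treeValue ℓ n z).2 hb hb' hu hv huv).trans ?_
  simp only [smul_eq_mul]
  gcongr
  · exact Finset.le_sup' (treeValue ℓ n b) (Finset.mem_univ z)
  · exact Finset.le_sup' (treeValue ℓ n b') (Finset.mem_univ z)

theorem seqRad_average_le (ℓ : F → X → ℝ) (n : ℕ) (b : F → ℝ) (y : X) :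
    2⁻¹ * seqRad ℓ n (fun f => b f - 2 * ℓ f y) + 2⁻¹ * seqRad ℓ n (fun f => b f + 2 * ℓ f y) ≤
      seqRad ℓ (n + 1) b := by
  obtain ⟨z₁, -, h₁⟩ := Finset.exists_mem_eq_sup' Finset.univ_nonempty
    (treeValue ℓ n (fun f => b f - 2 * ℓ f y))
  obtain ⟨z₂, -, h₂⟩ := Finset.exists_mem_eq_sup' Finset.univ_nonempty
    (treeValue ℓ n (fun f => b f + 2 * ℓ f y))
  rw [seqRad, seqRad, h₁, h₂]
  have := treeValue_joinTree ℓ b y (fun c => if c then z₁ else z₂)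
  simp only [if_true, Bool.false_eq_true, if_false] at this
  exact this ▸ Finset.le_sup' (treeValue ℓ (n + 1) b) (Finset.mem_univ _)

/-- Symmetrization: the losses at two independent draws from `p` may be replaced by
a random sign times twice the loss at a single draw. -/
theorem sum_seqRad_le (ℓ : F → X → ℝ) (n : ℕ) (b : F → ℝ) {p : X → ℝ}
    (hp : p ∈ stdSimplex ℝ X) :
    ∑ y, p y * seqRad ℓ n (fun f => b f - ∑ w, p w * ℓ f w + ℓ f y) ≤ seqRad ℓ (n + 1) b := by
  set P : X → ℝ := fun y => seqRad ℓ n (fun f => b f + 2 * ℓ f y)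
  set N : X → ℝ := fun y => seqRad ℓ n (fun f => b f - 2 * ℓ f y)
  have key : ∀ y, seqRad ℓ n (fun f => b f - ∑ w, p w * ℓ f w + ℓ f y) ≤
      2⁻¹ * ∑ w, p w * N w + 2⁻¹ * P y := by
    intro y
    have hJ := (convexOn_seqRad ℓ n).map_sum_le (t := Finset.univ) (w := p)
      (p := fun w f => b f - 2 * ℓ f w) (fun w _ => hp.1 w) hp.2 (fun _ _ => Set.mem_univ _)
    have hC := (convexOn_seqRad ℓ n).2 (Set.mem_univ (∑ w, p w • fun f => b f - 2 * ℓ f w))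
      (Set.mem_univ fun f => b f + 2 * ℓ f y) (by norm_num : (0 : ℝ) ≤ 2⁻¹)
      (by norm_num : (0 : ℝ) ≤ 2⁻¹) (by norm_num)
    have hE : (fun f => b f - ∑ w, p w * ℓ f w + ℓ f y) =
        (2⁻¹ : ℝ) • (∑ w, p w • fun f => b f - 2 * ℓ f w) +
          (2⁻¹ : ℝ) • fun f => b f + 2 * ℓ f y := by
      funext f
      simp only [Pi.add_apply, Pi.smul_apply, Finset.sum_apply, smul_eq_mul, mul_sub,
        Finset.sum_sub_distrib, ← Finset.sum_mul, hp.2, mul_left_comm _ (2 : ℝ),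
        ← Finset.mul_sum]
      ring
    rw [hE]
    refine hC.trans ?_
    simp only [smul_eq_mul] at hJ ⊢
    gcongr
  calc _ ≤ ∑ y, p y * (2⁻¹ * ∑ w, p w * N w + 2⁻¹ * P y) :=
        Finset.sum_le_sum fun y _ => mul_le_mul_of_nonneg_left (key y) (hp.1 y)
    _ = ∑ y, p y * (2⁻¹ * N y + 2⁻¹ * P y) := by
        simp only [mul_add, Finset.sum_add_distrib, ← Finset.sum_mul, hp.2, one_mul,
          mul_left_comm _ (2⁻¹ : ℝ), ← Finset.mul_sum]
    _ ≤ ∑ y, p y * seqRad ℓ (n + 1) b :=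
        Finset.sum_le_sum fun y _ =>
          mul_le_mul_of_nonneg_left (seqRad_average_le ℓ n b y) (hp.1 y)
    _ = seqRad ℓ (n + 1) b := by rw [← Finset.sum_mul, hp.2, one_mul]

theorem exists_mixed_seqRad_le (ℓ : F → X → ℝ) (n : ℕ) (b : F → ℝ) :
    ∃ q ∈ stdSimplex ℝ F, ∀ y,
      ∑ f, q f * ℓ f y + seqRad ℓ n (fun f => b f + ℓ f y) ≤ seqRad ℓ (n + 1) b := by
  obtain ⟨q, hq, p, hp, h⟩ := exists_mixed_saddle
    (fun f y => ℓ f y + seqRad ℓ n (fun f => b f + ℓ f y))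
  refine ⟨q, hq, fun y => ?_⟩
  simp only [mul_add, Finset.sum_add_distrib, ← Finset.sum_mul, hq.2, one_mul] at h
  set v := ∑ f, q f * ℓ f y + seqRad ℓ n (fun f => b f + ℓ f y)
  set C := ∑ w, p w * seqRad ℓ n (fun f => b f + ℓ f w) with hC
  calc v = ∑ w, p w * (seqRad ℓ n (fun f => b f + ℓ f w) + (v - C)) := by
        simp only [mul_add, Finset.sum_add_distrib, ← Finset.sum_mul, hp.2, ← hC]
        ring
    _ ≤ ∑ w, p w * seqRad ℓ n (fun f => b f - ∑ w', p w' * ℓ f w' + ℓ f w) := by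
        refine Finset.sum_le_sum fun w _ => mul_le_mul_of_nonneg_left
          (seqRad_add_le ℓ n fun f => ?_) (hp.1 w)
        linarith [h f y]
    _ ≤ _ := sum_seqRad_le ℓ n b hp

theorem seqRad_zero (ℓ : F → X → ℝ) (b : F → ℝ) :
    seqRad ℓ 0 b = -Finset.univ.inf' Finset.univ_nonempty b := by
  have h : ∀ z, treeValue ℓ 0 b z = -Finset.univ.inf' Finset.univ_nonempty b := by
    intro z
    simp only [treeValue, pathSum, pow_zero, one_mul, Finset.univ_unique, Finset.sum_singleton,
      Finset.univ_eq_empty, Finset.sum_empty, mul_zero, zero_sub]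
    refine le_antisymm (Finset.sup'_le _ _ fun f hf => neg_le_neg (Finset.inf'_le b hf)) ?_
    obtain ⟨f, hf, hfb⟩ := Finset.exists_mem_eq_inf' Finset.univ_nonempty b
    exact hfb ▸ Finset.le_sup' (fun f => -b f) hf
  simp only [seqRad, funext h, Finset.sup'_const]

end SeqRad

/-- the conditional sequential Rademacher complexity is an admissible
relaxation (Proposition 2). -/
theorem condSeqRad_admissible
    {F X : Type*} [Fintype F] [Nonempty F] [Fintype X] [Nonempty X]
    (ℓ : F → X → ℝ) (T : ℕ) (hT : 0 < T) :
    (∀ t : ℕ, t < T → ∀ x : Fin t → X,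
      ∃ q : F → ℝ, (∀ f, 0 ≤ q f) ∧ (∑ f, q f) = 1 ∧
        ∀ y : X,
          (∑ f, q f * ℓ f y) + condSeqRad ℓ T (t + 1) (Fin.snoc x y)
            ≤ condSeqRad ℓ T t x) ∧
    (∀ x : Fin T → X,
      condSeqRad ℓ T T x =
        - Finset.univ.inf' Finset.univ_nonempty (fun f : F => ∑ s : Fin T, ℓ f (x s))) := by
  refine ⟨fun t ht x => ?_, fun x => ?_⟩
  · obtain ⟨q, hq, h⟩ := exists_mixed_seqRad_le ℓ (T - (t + 1)) (fun f => ∑ s, ℓ f (x s))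
    refine ⟨q, hq.1, hq.2, fun y => ?_⟩
    rw [condSeqRad_eq_seqRad, condSeqRad_eq_seqRad,
      show T - t = T - (t + 1) + 1 by lia]
    simpa only [Fin.sum_univ_castSucc, Fin.snoc_castSucc, Fin.snoc_last] using h y
  · rw [condSeqRad_eq_seqRad, Nat.sub_self, seqRad_zero]
end

section
/- Let F and X be nonempty finite sets, T a positive integer, and ℓ : F × X → ℝ with |ℓ(f,x)| ≤ 1 for all f ∈ F, x ∈ X. Then for every 0 ≤ t ≤ T, every x_1,…,x_t ∈ X, and every real λ > 0, the conditional sequential Rademacher complexity satisfies R_T(F | x_1,…,x_t) ≤ (1/λ)·log( Σ_{f∈F} exp(−λ Σ_{i=1}^{t} ℓ(f,x_i)) ) + 2λ(T−t). -/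
/-- Exponential moment bound for a bounded predictable process driven by independent signs. -/
theorem sum_exp_signed_tree_le (a : ℝ) :
    ∀ (n : ℕ) (g : (s : Fin n) → (Fin s.val → Bool) → ℝ), (∀ s e, |g s e| ≤ 1) →
      ∑ ε : Fin n → Bool, Real.exp (a * ∑ s : Fin n, (if ε s then (1 : ℝ) else -1) *
        g s (fun i => ε (Fin.castLT i (lt_trans i.isLt s.isLt))))
      ≤ 2 ^ n * Real.exp (n * (a ^ 2 / 2)) := by
  intro n
  induction n with
  | zero => intro g _; simp
  | succ n ih =>
    intro g hg
    have two_point (u : ℝ) (hu : |u| ≤ 1) :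
        Real.exp (a * u) + Real.exp (-(a * u)) ≤ 2 * Real.exp (a ^ 2 / 2) := by
      have h_cosh := Real.cosh_le_exp_half_sq (a * u)
      rw [Real.cosh_eq] at h_cosh
      have h_sq : (a * u) ^ 2 / 2 ≤ a ^ 2 / 2 := by
        have : u ^ 2 ≤ 1 := (sq_le_one_iff_abs_le_one u).2 hu
        nlinarith [sq_nonneg a]
      linarith [Real.exp_le_exp.2 h_sq]
    rw [← (Fin.snocEquiv (fun _ => Bool)).sum_comp, Fintype.sum_prod_type, Fintype.sum_bool,
      ← Finset.sum_add_distrib]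
    have hprev := ih (fun s e => g s.castSucc e) (fun s e => hg _ _)
    calc _ ≤ ∑ ε : Fin n → Bool, Real.exp (a * ∑ s : Fin n, (if ε s then (1 : ℝ) else -1) *
            g s.castSucc (fun i => ε (Fin.castLT i (lt_trans i.isLt s.isLt)))) *
            (2 * Real.exp (a ^ 2 / 2)) := by
          refine Finset.sum_le_sum fun ε _ => ?_
          have hpath (b : Bool) (s : Fin n) :
              (fun i : Fin s.castSucc.val => (Fin.snoc ε b : Fin (n + 1) → Bool)
                (Fin.castLT i (lt_trans i.isLt s.castSucc.isLt)))
              = fun i : Fin s.val => ε (Fin.castLT i (lt_trans i.isLt s.isLt)) :=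
            funext fun i => Fin.snoc_castSucc (α := fun _ => Bool) b ε
              (Fin.castLT i (lt_trans i.isLt s.isLt))
          have hlast (b : Bool) :
              (fun i : Fin (Fin.last n).val => (Fin.snoc ε b : Fin (n + 1) → Bool)
                (Fin.castLT i (lt_trans i.isLt (Fin.last n).isLt))) = ε :=
            funext fun i => Fin.snoc_castSucc (α := fun _ => Bool) b ε i
          simp only [Fin.snocEquiv, Equiv.coe_fn_mk, Fin.sum_univ_castSucc, hpath, hlast,
            Fin.snoc_castSucc, Fin.snoc_last]
          rw [mul_add, mul_add, Real.exp_add, Real.exp_add, ← mul_add]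
          refine mul_le_mul_of_nonneg_left ?_ (Real.exp_pos _).le
          simpa using two_point (g (Fin.last n) ε) (hg _ _)
      _ ≤ 2 ^ n * Real.exp (n * (a ^ 2 / 2)) * (2 * Real.exp (a ^ 2 / 2)) := by
          rw [← Finset.sum_mul]
          exact mul_le_mul_of_nonneg_right hprev (by positivity)
      _ = _ := by
          push_cast
          rw [add_mul, one_mul, Real.exp_add, pow_succ]
          ring

/-- Averaged soft-max bound: `log c` dominates the mean of a function whose exponential has
mean at most `c`. -/
theorem mean_le_log_of_sum_exp_le {ι : Type*} [Fintype ι] [Nonempty ι] (A : ι → ℝ) {c : ℝ}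
    (hc : 0 < c) (h : ∑ i, Real.exp (A i) ≤ Fintype.card ι * c) :
    (Fintype.card ι : ℝ)⁻¹ * ∑ i, A i ≤ Real.log c := by
  have hcard : (0 : ℝ) < Fintype.card ι := by exact_mod_cast Fintype.card_pos
  have hpt (i : ι) : A i ≤ Real.log c + (Real.exp (A i) / c - 1) := by
    have hlog := Real.log_le_sub_one_of_pos (div_pos (Real.exp_pos (A i)) hc)
    rw [Real.log_div (Real.exp_pos _).ne' hc.ne', Real.log_exp] at hlog
    linarith
  have hsum := Finset.sum_le_sum fun i (_ : i ∈ Finset.univ) => hpt i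
  rw [Finset.sum_add_distrib, Finset.sum_sub_distrib, ← Finset.sum_div] at hsum
  simp only [Finset.sum_const, Finset.card_univ, nsmul_eq_mul, mul_one] at hsum
  rw [inv_mul_le_iff₀ hcard]
  linarith [(div_le_iff₀ hc).2 h]

/-- Along a fixed tree `z`, the expected maximum of signed losses penalized by `L` is at most the
soft-max of `-L` at inverse temperature `lam` plus a linear term in the depth. -/
theorem mean_sup_signed_tree_sub_le {F X : Type*} [Fintype F] [Nonempty F] {ℓ : F → X → ℝ}
    (hℓ : ∀ f x, |ℓ f x| ≤ 1) {m : ℕ} (z : (s : Fin m) → (Fin s.val → Bool) → X)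
    (L : F → ℝ) {lam : ℝ} (hlam : 0 < lam) :
    (2 : ℝ)⁻¹ ^ m * ∑ ε : Fin m → Bool,
      Finset.univ.sup' Finset.univ_nonempty (fun f : F =>
        2 * (∑ s : Fin m, (if ε s then (1 : ℝ) else -1) *
          ℓ f (z s (fun i => ε (Fin.castLT i (lt_trans i.isLt s.isLt))))) - L f) ≤
      (1 / lam) * Real.log (∑ f : F, Real.exp (-lam * L f)) + 2 * lam * m := by
  set S : F → (Fin m → Bool) → ℝ := fun f ε => ∑ s : Fin m, (if ε s then (1 : ℝ) else -1) *
    ℓ f (z s (fun i => ε (Fin.castLT i (lt_trans i.isLt s.isLt))))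
  set M : (Fin m → Bool) → ℝ := fun ε =>
    Finset.univ.sup' Finset.univ_nonempty fun f => 2 * S f ε - L f
  set W : ℝ := ∑ f, Real.exp (-lam * L f)
  have hW : 0 < W := Finset.sum_pos (fun f _ => Real.exp_pos _) Finset.univ_nonempty
  have hmax (ε : Fin m → Bool) :
      Real.exp (lam * M ε) ≤ ∑ f, Real.exp (-lam * L f) * Real.exp (2 * lam * S f ε) := by
    obtain ⟨f, -, hf⟩ := Finset.exists_mem_eq_sup' Finset.univ_nonempty
      fun f => 2 * S f ε - L f
    have hM : M ε = 2 * S f ε - L f := hf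
    calc Real.exp (lam * M ε) = Real.exp (-lam * L f) * Real.exp (2 * lam * S f ε) := by
          rw [hM, ← Real.exp_add]
          ring_nf
      _ ≤ _ := Finset.single_le_sum
          (f := fun f => Real.exp (-lam * L f) * Real.exp (2 * lam * S f ε))
          (fun _ _ => by positivity) (Finset.mem_univ f)
  have hsum : ∑ ε, Real.exp (lam * M ε) ≤
      Fintype.card (Fin m → Bool) * (W * Real.exp (m * ((2 * lam) ^ 2 / 2))) :=
    calc _ ≤ ∑ ε, ∑ f, Real.exp (-lam * L f) * Real.exp (2 * lam * S f ε) :=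
          Finset.sum_le_sum fun ε _ => hmax ε
      _ = ∑ f, Real.exp (-lam * L f) * ∑ ε, Real.exp (2 * lam * S f ε) := by
          rw [Finset.sum_comm]
          simp only [Finset.mul_sum]
      _ ≤ ∑ f, Real.exp (-lam * L f) * (2 ^ m * Real.exp (m * ((2 * lam) ^ 2 / 2))) := by
          gcongr with f
          exact sum_exp_signed_tree_le (2 * lam) m (fun s e => ℓ f (z s e)) fun s e => hℓ _ _
      _ = _ := by
          rw [← Finset.sum_mul]
          simp only [Fintype.card_pi, Fintype.card_bool, Finset.prod_const, Finset.card_univ,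
            Fintype.card_fin, Nat.cast_pow, Nat.cast_ofNat]
          ring
  have hmean := mean_le_log_of_sum_exp_le _ (by positivity) hsum
  rw [Real.log_mul hW.ne' (Real.exp_pos _).ne', Real.log_exp, ← Finset.mul_sum] at hmean
  simp only [Fintype.card_pi, Fintype.card_bool, Finset.prod_const, Finset.card_univ,
    Fintype.card_fin, Nat.cast_pow, Nat.cast_ofNat] at hmean
  rw [← mul_le_mul_iff_right₀ hlam]
  change lam * ((2 : ℝ)⁻¹ ^ m * ∑ ε, M ε) ≤ lam * (1 / lam * Real.log W + 2 * lam * m)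
  calc lam * ((2 : ℝ)⁻¹ ^ m * ∑ ε, M ε) = (2 ^ m)⁻¹ * (lam * ∑ ε, M ε) := by
        rw [inv_pow]
        ring
    _ ≤ _ := hmean
    _ = _ := by
        field_simp

/-- the Exponential Weights relaxation upper bounds the conditional
sequential Rademacher complexity of a finite class with loss bounded by 1
(first claim of Proposition 3). -/
theorem condSeqRad_le_expWeights_relaxation
    {F X : Type*} [Fintype F] [Nonempty F] [Fintype X] [Nonempty X]
    (ℓ : F → X → ℝ) (T : ℕ) (hT : 0 < T)
    (hℓ : ∀ f x, |ℓ f x| ≤ 1)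
    (t : ℕ) (ht : t ≤ T) (x : Fin t → X) (lam : ℝ) (hlam : 0 < lam) :
    condSeqRad ℓ T t x ≤
      (1 / lam) * Real.log (∑ f : F, Real.exp (-lam * ∑ s : Fin t, ℓ f (x s)))
        + 2 * lam * ((T : ℝ) - t) := by
  unfold condSeqRad
  rw [← Nat.cast_sub ht]
  exact Finset.sup'_le _ _ fun z _ => mean_sup_signed_tree_sub_le hℓ z _ hlam
end

section
/- Let F be a nonempty finite set, X a nonempty set, T a positive integer, 1 ≤ t ≤ T, and ℓ : F × X → ℝ with |ℓ(f,x)| ≤ 1 for all f, x. Fix x_1,…,x_{t−1} ∈ X and set L(f) = Σ_{i=1}^{t−1} ℓ(f,x_i). Define Rel_{t−1} = inf_{λ>0} [ (1/λ)·log( Σ_{f∈F} exp(−λ L(f)) ) + 2λ(T−t+1) ] and, for x ∈ X, Rel_t(x) = inf_{λ>0} [ (1/λ)·log( Σ_{f∈F} exp(−λ(L(f)+ℓ(f,x))) ) + 2λ(T−t) ]. Suppose λ* > 0 attains the infimum defining Rel_{t−1}, and let q(f) = exp(−λ* L(f)) / Σ_{g∈F} exp(−λ* L(g)) be the Exponential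 Weights distribution. Then for every x ∈ X: Σ_{f∈F} q(f)·ℓ(f,x) + Rel_t(x) ≤ Rel_{t−1}. -/
/-- A bound on the moment generating function of a random variable with values in `[-1, 1]`,
with the (non-optimal) variance proxy `4`. -/
theorem sum_mul_exp_neg_mul_le {F : Type*} [Fintype F] {q a : F → ℝ} (hq : ∀ f, 0 ≤ q f)
    (hq1 : ∑ f, q f = 1) (ha : ∀ f, |a f| ≤ 1) (l : ℝ) :
    ∑ f, q f * Real.exp (-l * a f) ≤ Real.exp (-l * ∑ f, q f * a f + 2 * l ^ 2) := by
  set m := ∑ f, q f * a f with hm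
  have hm1 : |m| ≤ 1 := by
    calc |m| ≤ ∑ f, |q f * a f| := Finset.abs_sum_le_sum_abs _ _
      _ ≤ ∑ f, q f := by
        refine Finset.sum_le_sum fun f _ => ?_
        rw [abs_mul, abs_of_nonneg (hq f)]
        exact mul_le_of_le_one_right (hq f) (ha f)
      _ = 1 := hq1
  have hpt (f : F) : Real.exp (-l * a f) ≤
      Real.exp (-l * m) * (Real.cosh (2 * l) + (m - a f) / 2 * Real.sinh (2 * l)) := by
    have hdev : |(m - a f) / 2| ≤ 1 := by
      have h1 := abs_le.mp hm1
      have h2 := abs_le.mp (ha f)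
      exact abs_le.mpr ⟨by linarith, by linarith⟩
    calc Real.exp (-l * a f)
        = Real.exp (-l * m) * Real.exp ((m - a f) / 2 * (2 * l)) := by
          rw [← Real.exp_add]; ring_nf
      _ ≤ _ := by gcongr; exact Real.exp_mul_le_cosh_add_mul_sinh hdev _
  have hmean : ∑ f, q f * (Real.exp (-l * m) *
      (Real.cosh (2 * l) + (m - a f) / 2 * Real.sinh (2 * l)))
      = Real.exp (-l * m) * Real.cosh (2 * l) := by
    calc _ = ∑ f, (q f * (Real.exp (-l * m) * (Real.cosh (2 * l) + m / 2 * Real.sinh (2 * l)))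
            - q f * a f * (Real.exp (-l * m) * Real.sinh (2 * l) / 2)) :=
          Finset.sum_congr rfl fun f _ => by ring
      _ = _ := by
          rw [Finset.sum_sub_distrib, ← Finset.sum_mul, ← Finset.sum_mul, hq1, ← hm]; ring
  calc ∑ f, q f * Real.exp (-l * a f)
      ≤ ∑ f, q f * (Real.exp (-l * m) *
          (Real.cosh (2 * l) + (m - a f) / 2 * Real.sinh (2 * l))) :=
        Finset.sum_le_sum fun f _ => mul_le_mul_of_nonneg_left (hpt f) (hq f)
    _ = Real.exp (-l * m) * Real.cosh (2 * l) := hmean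
    _ ≤ Real.exp (-l * m) * Real.exp ((2 * l) ^ 2 / 2) := by
        gcongr; exact Real.cosh_le_exp_half_sq _
    _ = _ := by rw [← Real.exp_add]; ring_nf

/-- The soft minimum `-(1 / l) * log (∑ g, exp (-l * a g))` is at most each `a f`. -/
theorem neg_le_one_div_mul_log_sum_exp {F : Type*} [Fintype F] (a : F → ℝ) (f : F) {l : ℝ}
    (hl : 0 < l) : -a f ≤ (1 / l) * Real.log (∑ g, Real.exp (-l * a g)) := by
  have hle : Real.exp (-l * a f) ≤ ∑ g, Real.exp (-l * a g) :=
    Finset.single_le_sum (f := fun g => Real.exp (-l * a g))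
      (fun g _ => (Real.exp_pos _).le) (Finset.mem_univ f)
  have hlog := Real.log_le_log (Real.exp_pos _) hle
  rw [Real.log_exp] at hlog
  rw [one_div_mul_eq_div, le_div_iff₀ hl]
  linarith


/-- admissibility of the Exponential Weights relaxation, played with the
Exponential Weights distribution at the optimal learning rate λ* of the previous
round (admissibility claim of Proposition 3). -/
theorem expWeights_admissible
    {F X : Type*} [Fintype F] [Nonempty F] [Nonempty X]
    (ℓ : F → X → ℝ) (hℓ : ∀ f x, |ℓ f x| ≤ 1)
    (T t : ℕ) (ht1 : 1 ≤ t) (ht2 : t ≤ T)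
    (x : Fin (t - 1) → X)
    (L : F → ℝ) (hL : ∀ f, L f = ∑ i : Fin (t - 1), ℓ f (x i))
    (lstar : ℝ) (hlstar : 0 < lstar)
    (hattain : (1 / lstar) * Real.log (∑ f : F, Real.exp (-lstar * L f))
          + 2 * lstar * ((T : ℝ) - t + 1)
        = sInf ((fun l : ℝ =>
            (1 / l) * Real.log (∑ f : F, Real.exp (-l * L f))
              + 2 * l * ((T : ℝ) - t + 1)) '' Set.Ioi 0))
    (q : F → ℝ)
    (hq : ∀ f, q f = Real.exp (-lstar * L f) / ∑ g : F, Real.exp (-lstar * L g)) :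
    ∀ y : X,
      (∑ f, q f * ℓ f y)
          + sInf ((fun l : ℝ =>
              (1 / l) * Real.log (∑ f : F, Real.exp (-l * (L f + ℓ f y)))
                + 2 * l * ((T : ℝ) - t)) '' Set.Ioi 0)
        ≤ sInf ((fun l : ℝ =>
            (1 / l) * Real.log (∑ f : F, Real.exp (-l * L f))
              + 2 * l * ((T : ℝ) - t + 1)) '' Set.Ioi 0) := by
  intro y
  rw [← hattain]
  obtain ⟨f₀⟩ := ‹Nonempty F›
  have hbdd : BddBelow ((fun l : ℝ =>
      (1 / l) * Real.log (∑ f : F, Real.exp (-l * (L f + ℓ f y)))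
        + 2 * l * ((T : ℝ) - t)) '' Set.Ioi 0) := by
    refine ⟨-(L f₀ + ℓ f₀ y), ?_⟩
    rintro _ ⟨l, hl, rfl⟩
    have hsoft := neg_le_one_div_mul_log_sum_exp (fun f => L f + ℓ f y) f₀ hl
    have hT : (0 : ℝ) ≤ T - t := sub_nonneg.mpr (by exact_mod_cast ht2)
    have hl0 : (0 : ℝ) < l := hl
    have hrest : 0 ≤ 2 * l * ((T : ℝ) - t) := by positivity
    dsimp only at hsoft ⊢
    linarith
  have hinf := csInf_le hbdd (Set.mem_image_of_mem _ (Set.mem_Ioi.mpr hlstar))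
  set Z := ∑ g : F, Real.exp (-lstar * L g)
  have hZ : 0 < Z := Finset.sum_pos (fun g _ => Real.exp_pos _) ⟨f₀, Finset.mem_univ _⟩
  have hq0 (f : F) : 0 ≤ q f := by rw [hq]; positivity
  have hq1 : ∑ f, q f = 1 := by
    simp_rw [hq, ← Finset.sum_div]
    exact div_self hZ.ne'
  have hsum : ∑ f : F, Real.exp (-lstar * (L f + ℓ f y))
      = Z * ∑ f, q f * Real.exp (-lstar * ℓ f y) := by
    rw [Finset.mul_sum]
    refine Finset.sum_congr rfl fun f _ => ?_
    rw [hq, mul_add, Real.exp_add]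
    field_simp
  have hlog : Real.log (∑ f : F, Real.exp (-lstar * (L f + ℓ f y)))
      ≤ Real.log Z + (-lstar * ∑ f, q f * ℓ f y + 2 * lstar ^ 2) := by
    rw [← Real.log_exp (-lstar * ∑ f, q f * ℓ f y + 2 * lstar ^ 2),
      ← Real.log_mul hZ.ne' (Real.exp_pos _).ne']
    refine Real.log_le_log
      (Finset.sum_pos (fun g _ => Real.exp_pos _) ⟨f₀, Finset.mem_univ _⟩) ?_
    rw [hsum]
    exact mul_le_mul_of_nonneg_left
      (sum_mul_exp_neg_mul_le hq0 hq1 (fun f => hℓ f y) lstar) hZ.le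
  have hdiv := mul_le_mul_of_nonneg_left hlog (one_div_pos.mpr hlstar).le
  have hexpand : (1 / lstar) * (Real.log Z + (-lstar * ∑ f, q f * ℓ f y + 2 * lstar ^ 2))
      = (1 / lstar) * Real.log Z - ∑ f, q f * ℓ f y + 2 * lstar := by
    field_simp
    ring
  linarith
end

section
/- Let H be a real inner product space, k a natural number, v ∈ H, and z = (z_1,…,z_k) an H-valued tree of depth k whose values all lie in the closed unit ball of H (that is, z_s : {−1,1}^{s−1} → H with ‖z_s(ε)‖ ≤ 1 for all s and ε). Then 2^{−k} Σ_{ε∈{−1,1}^k} ‖ v + Σ_{s=1}^{k} ε_s z_s(ε_1,…,ε_{s−1}) ‖ ≤ √( ‖v‖² + k ). -/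
/-- The sum over all sign sequences of `‖v + Σ_s ε_s z_s(ε)‖²` for a tree in the unit ball. -/
theorem tree_sum_norm_sq_le
    {H : Type*} [NormedAddCommGroup H] [InnerProductSpace ℝ H]
    (k : ℕ) (v : H)
    (z : (s : Fin k) → (Fin s.val → Bool) → H)
    (hz : ∀ s ε, ‖z s ε‖ ≤ 1) :
    ∑ ε : Fin k → Bool,
        ‖v + ∑ s : Fin k, (if ε s then (1 : ℝ) else -1) •
            z s (fun i => ε (Fin.castLT i (lt_trans i.isLt s.isLt)))‖ ^ 2
      ≤ 2 ^ k * (‖v‖ ^ 2 + k) := by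
  induction k with
  | zero => simp
  | succ k ih =>
    have hprefix := ih (fun s => z s.castSucc) (fun s ε => hz s.castSucc ε)
    rw [← (Fin.snocEquiv (fun _ => Bool)).sum_comp, Fintype.sum_prod_type_right]
    set w : (Fin k → Bool) → H := fun ε =>
      v + ∑ s : Fin k, (if ε s then (1 : ℝ) else -1) •
        z s.castSucc (fun i => ε (Fin.castLT i (lt_trans i.isLt s.isLt))) with hw
    have hsplit : ∀ (ε : Fin k → Bool) (b : Bool),
        v + ∑ s : Fin (k + 1),
          (if Fin.snocEquiv (fun _ => Bool) (b, ε) s then (1 : ℝ) else -1) •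
            z s (fun i => Fin.snocEquiv (fun _ => Bool) (b, ε)
              (Fin.castLT i (lt_trans i.isLt s.isLt)))
          = w ε + (if b then (1 : ℝ) else -1) • z (Fin.last k) ε := by
      intro ε b
      have hcast : ∀ (i : ℕ) (hi : i < k) (hi' : i < k + 1),
          (Fin.snoc ε b : Fin (k + 1) → Bool) ⟨i, hi'⟩ = ε ⟨i, hi⟩ := fun i hi hi' =>
        Fin.snoc_castSucc (α := fun _ => Bool) b ε ⟨i, hi⟩
      rw [Fin.sum_univ_castSucc, ← add_assoc]
      simp only [Fin.snocEquiv_apply, Fin.snoc_castSucc, Fin.snoc_last, hw]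
      refine congrArg₂ (· + ·) (congrArg (v + ·) (Finset.sum_congr rfl fun s _ => ?_)) ?_
      · exact congrArg (_ • z s.castSucc ·) (funext fun i => hcast i (lt_trans i.isLt s.isLt) _)
      · exact congrArg (_ • z (Fin.last k) ·) (funext fun i => hcast i i.isLt _)
    have hstep : ∀ ε : Fin k → Bool,
        ∑ b : Bool, ‖w ε + (if b then (1 : ℝ) else -1) • z (Fin.last k) ε‖ ^ 2
          ≤ 2 * ‖w ε‖ ^ 2 + 2 := by
      intro ε
      have hpar := parallelogram_law_with_norm ℝ (w ε) (z (Fin.last k) ε)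
      have hone := hz (Fin.last k) ε
      have hnonneg := norm_nonneg (z (Fin.last k) ε)
      simp only [Fintype.sum_bool, if_true, Bool.false_eq_true, if_false, one_smul, neg_smul,
        ← sub_eq_add_neg]
      nlinarith
    simp only [hsplit]
    calc _ ≤ ∑ ε : Fin k → Bool, (2 * ‖w ε‖ ^ 2 + 2) := Finset.sum_le_sum fun ε _ => hstep ε
      _ = 2 * ∑ ε : Fin k → Bool, ‖w ε‖ ^ 2 + 2 ^ k * 2 := by
        simp [Finset.sum_add_distrib, Finset.mul_sum]
      _ ≤ 2 * (2 ^ k * (‖v‖ ^ 2 + k)) + 2 ^ k * 2 := by gcongr; exact hprefix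
      _ = _ := by push_cast; ring

/-- derivation of the Mirror Descent relaxation in the Euclidean case:
for any `H`-valued tree of depth `k` with values in the unit ball, the average over
sign sequences of `‖v + Σ_s ε_s z_s(ε)‖` is at most `√(‖v‖² + k)`. -/
theorem tree_average_norm_le
    {H : Type*} [NormedAddCommGroup H] [InnerProductSpace ℝ H]
    (k : ℕ) (v : H)
    (z : (s : Fin k) → (Fin s.val → Bool) → H)
    (hz : ∀ s ε, ‖z s ε‖ ≤ 1) :
    (2 : ℝ)⁻¹ ^ k *
        ∑ ε : Fin k → Bool,
          ‖v + ∑ s : Fin k, (if ε s then (1 : ℝ) else -1) •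
              z s (fun i => ε (Fin.castLT i (lt_trans i.isLt s.isLt)))‖
      ≤ Real.sqrt (‖v‖ ^ 2 + k) := by
  apply Real.le_sqrt_of_sq_le
  have hsq := tree_sum_norm_sq_le k v z hz
  have hcs := sq_sum_le_card_mul_sum_sq (s := (Finset.univ : Finset (Fin k → Bool)))
    (f := fun ε => ‖v + ∑ s : Fin k, (if ε s then (1 : ℝ) else -1) •
      z s (fun i => ε (Fin.castLT i (lt_trans i.isLt s.isLt)))‖)
  simp only [Finset.card_univ, Fintype.card_pi, Fintype.card_bool, Finset.prod_const,
    Fintype.card_fin, Nat.cast_pow, Nat.cast_ofNat] at hcs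
  rw [mul_pow]
  calc _ ≤ ((2 : ℝ)⁻¹ ^ k) ^ 2 * (2 ^ k * (2 ^ k * (‖v‖ ^ 2 + k))) := by
        gcongr
        exact hcs.trans (by gcongr)
    _ = _ := by
        rw [inv_pow]
        field_simp
end

section
/- Let F be a nonempty finite set, X a nonempty set, ℓ : F × X → ℝ, T a positive integer, and k_1,…,k_m positive integers with k_1 + ⋯ + k_m = T; write k̃_i = k_1 + ⋯ + k_i (with k̃_0 = 0). For t ≥ 0, x_1,…,x_t ∈ X and k ≥ 1 define the localized class F^k(x_1,…,x_t) = { f ∈ F : there exist x_{t+1},…,x_{t+k} ∈ X with Σ_{i=1}^{t+k} ℓ(f,x_i) = min_{g∈F} Σ_{i=1}^{t+k} ℓ(g,x_i) }. Then for every x_1,…,x_T ∈ X, each set F^{k_i}(x_1,…,x_{k̃_{i−1}}) is nonempty and min_{f∈F} Σ_{t=1}^T ℓ(f,x_t) ≥ Σ_{i=1}^m min_{f ∈ F^{k_i}(x_1,…,x_{k̃_{i−1}})} Σ_{t=k̃_{i−1}+1}^{k̃_i} ℓ(f,x_t); equivalently, for any plays f_1,…,f_T ∈ F, the regret Σ_{t=1}^T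 ℓ(f_t,x_t) − min_{f∈F} Σ_{t=1}^T ℓ(f,x_t) is at most Σ_{t=1}^T ℓ(f_t,x_t) − Σ_{i=1}^m min_{f ∈ F^{k_i}(x_1,…,x_{k̃_{i−1}})} Σ_{t=k̃_{i−1}+1}^{k̃_i} ℓ(f,x_t). -/
/-- The localized class `F^k(x_1, …, x_t)`: elements of `F` that are empirical risk
minimizers on `x_1, …, x_t` together with some `k` further points. -/
def localClass {F X : Type*} [Fintype F] [Nonempty F]
    (ℓ : F → X → ℝ) (x : ℕ → X) (t k : ℕ) : Set F :=
  {f | ∃ y : Fin k → X,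
    (∑ s ∈ Finset.range t, ℓ f (x s)) + ∑ j, ℓ f (y j) =
      Finset.univ.inf' Finset.univ_nonempty
        (fun g : F => (∑ s ∈ Finset.range t, ℓ g (x s)) + ∑ j, ℓ g (y j))}

theorem mem_localClass_of_forall_sum_le {F X : Type*} [Fintype F] [Nonempty F]
    (ℓ : F → X → ℝ) (x : ℕ → X) (t k : ℕ) (g : F)
    (hg : ∀ f, ∑ s ∈ Finset.range (t + k), ℓ g (x s) ≤
      ∑ s ∈ Finset.range (t + k), ℓ f (x s)) :
    g ∈ localClass ℓ x t k := by
  have key (f : F) : (∑ s ∈ Finset.range t, ℓ f (x s)) + ∑ j : Fin k, ℓ f (x (t + j)) =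
      ∑ s ∈ Finset.range (t + k), ℓ f (x s) := by
    rw [Finset.sum_range_add, Finset.sum_range (fun j => ℓ f (x (t + j)))]
  refine ⟨fun j => x (t + j), ?_⟩
  simp only [key]
  exact le_antisymm (Finset.le_inf' _ _ fun f _ => hg f)
    (Finset.inf'_le (fun f => ∑ s ∈ Finset.range (t + k), ℓ f (x s)) (Finset.mem_univ g))

theorem exists_sum_le_mem_localClass {F X : Type*} [Fintype F] [Nonempty F]
    (ℓ : F → X → ℝ) (x : ℕ → X) (t k : ℕ) :
    ∃ g ∈ localClass ℓ x t k, ∀ f, ∑ s ∈ Finset.range (t + k), ℓ g (x s) ≤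
      ∑ s ∈ Finset.range (t + k), ℓ f (x s) := by
  obtain ⟨g, hg⟩ := Finite.exists_min fun f : F => ∑ s ∈ Finset.range (t + k), ℓ f (x s)
  exact ⟨g, mem_localClass_of_forall_sum_le ℓ x t k g hg, hg⟩

theorem sum_sInf_localClass_le {F X : Type*} [Fintype F] [Nonempty F]
    (ℓ : F → X → ℝ) (x : ℕ → X) (k : ℕ → ℕ) (n : ℕ) (f : F) :
    ∑ i ∈ Finset.range n,
        sInf ((fun f : F => ∑ s ∈ Finset.Ico (∑ j ∈ Finset.range i, k j)
              (∑ j ∈ Finset.range (i + 1), k j), ℓ f (x s)) ''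
          localClass ℓ x (∑ j ∈ Finset.range i, k j) (k i))
      ≤ ∑ t ∈ Finset.range (∑ j ∈ Finset.range n, k j), ℓ f (x t) := by
  induction n generalizing f with
  | zero => simp
  | succ n ih =>
    obtain ⟨g, hgmem, hg⟩ :=
      exists_sum_le_mem_localClass ℓ x (∑ j ∈ Finset.range n, k j) (k n)
    rw [← Finset.sum_range_succ] at hg
    refine le_trans ?_ (hg f)
    rw [Finset.sum_range_succ, ← Finset.sum_range_add_sum_Ico (fun s => ℓ g (x s))
      (Finset.sum_range_succ k n ▸ Nat.le_add_right _ _ :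
        ∑ j ∈ Finset.range n, k j ≤ ∑ j ∈ Finset.range (n + 1), k j)]
    exact add_le_add (ih g)
      (csInf_le (Set.toFinite _).bddBelow (Set.mem_image_of_mem _ hgmem))

/-- the regret-splitting lemma (Lemma 19): the localized classes for any
blocking `k_1 + ⋯ + k_m = T` are nonempty, and the best cumulative loss is at least
the sum over blocks of the best localized loss over that block; equivalently, the
regret of any plays is at most the blockwise-localized regret bound. -/
theorem localized_regret_split
    {F X : Type*} [Fintype F] [Nonempty F] [Nonempty X]
    (ℓ : F → X → ℝ) (T : ℕ) (hT : 0 < T)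
    (m : ℕ) (k : ℕ → ℕ) (hk : ∀ i, i < m → 0 < k i)
    (hsum : ∑ i ∈ Finset.range m, k i = T)
    (x : ℕ → X) :
    (∀ i, i < m → (localClass ℓ x (∑ j ∈ Finset.range i, k j) (k i)).Nonempty) ∧
    (∑ i ∈ Finset.range m,
        sInf ((fun f : F => ∑ s ∈ Finset.Ico (∑ j ∈ Finset.range i, k j)
              (∑ j ∈ Finset.range (i + 1), k j), ℓ f (x s)) ''
          localClass ℓ x (∑ j ∈ Finset.range i, k j) (k i)))
      ≤ Finset.univ.inf' Finset.univ_nonempty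
          (fun f : F => ∑ t ∈ Finset.range T, ℓ f (x t)) ∧
    ∀ fs : ℕ → F,
      (∑ t ∈ Finset.range T, ℓ (fs t) (x t))
          - Finset.univ.inf' Finset.univ_nonempty
              (fun f : F => ∑ t ∈ Finset.range T, ℓ f (x t))
        ≤ (∑ t ∈ Finset.range T, ℓ (fs t) (x t))
          - ∑ i ∈ Finset.range m,
              sInf ((fun f : F => ∑ s ∈ Finset.Ico (∑ j ∈ Finset.range i, k j)
                    (∑ j ∈ Finset.range (i + 1), k j), ℓ f (x s)) ''
                localClass ℓ x (∑ j ∈ Finset.range i, k j) (k i)) := by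
  subst hsum
  have main := Finset.le_inf' Finset.univ_nonempty
    (fun f : F => ∑ t ∈ Finset.range (∑ i ∈ Finset.range m, k i), ℓ f (x t))
    fun f _ => sum_sInf_localClass_le ℓ x k m f
  refine ⟨fun i _ => ?_, main, fun _ => sub_le_sub_left main _⟩
  obtain ⟨g, hg, -⟩ := exists_sum_le_mem_localClass ℓ x (∑ j ∈ Finset.range i, k j) (k i)
  exact ⟨g, hg⟩
end

section
/- Let E be a real inner product space, s ⊆ E a convex set, σ > 0 and M ≥ 0 real numbers. Let G : E → ℝ be σ-strongly convex on s, and let g : E → ℝ be convex on s and M-Lipschitz on s. Suppose a ∈ s minimizes G over s (i.e., G(a) ≤ G(y) for all y ∈ s) and b ∈ s minimizes G + g over s (i.e., G(b) + g(b) ≤ G(y) + g(y) for all y ∈ s). Then ‖b − a‖ ≤ M/σ. -/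
/-- A strongly convex function grows at least quadratically away from a minimizer. -/
theorem StrongConvexOn.quadratic_growth_of_isMinOn
    {E : Type*} [NormedAddCommGroup E] [NormedSpace ℝ E] {s : Set E} {m : ℝ} {f : E → ℝ}
    (hf : StrongConvexOn s m f) {a y : E} (ha : a ∈ s) (hy : y ∈ s) (hmin : IsMinOn f s a) :
    m / 2 * ‖y - a‖ ^ 2 ≤ f y - f a := by
  have key : ∀ t : ℝ, 0 < t → t < 1 → (1 - t) * (m / 2 * ‖y - a‖ ^ 2) ≤ f y - f a := by
    intro t ht0 ht1
    have h1 := hf.2 hy ha ht0.le (sub_nonneg.2 ht1.le) (by ring)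
    have h2 := hmin (hf.1 hy ha ht0.le (sub_nonneg.2 ht1.le) (by ring))
    simp only [smul_eq_mul, Set.mem_ofPred_eq] at h1 h2
    refine le_of_mul_le_mul_left ?_ ht0
    linarith
  have hmin' : f a ≤ f y := hmin hy
  by_contra! h
  set K := m / 2 * ‖y - a‖ ^ 2
  have hK : 0 < K := by linarith
  have h3 := key ((K - (f y - f a)) / (2 * K)) (div_pos (by linarith) (by linarith))
    ((div_lt_one (by linarith)).2 (by linarith))
  field_simp at h3
  linarith

/-- localization for strongly convex objectives (Section 4.2.2): if `a`
minimizes a `σ`-strongly convex `G` over a convex set `s` and `b` minimizes `G + g`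
over `s` with `g` convex and `M`-Lipschitz on `s`, then `‖b − a‖ ≤ M/σ`. -/
theorem minimizer_shift_of_strongConvex
    {E : Type*} [NormedAddCommGroup E] [InnerProductSpace ℝ E]
    (s : Set E) (hs : Convex ℝ s) (σ M : ℝ) (hσ : 0 < σ) (hM : 0 ≤ M)
    (G g : E → ℝ)
    (hG : ConvexOn ℝ s (fun y => G y - σ / 2 * ‖y‖ ^ 2))
    (hg : ConvexOn ℝ s g)
    (hlip : ∀ a ∈ s, ∀ b ∈ s, |g a - g b| ≤ M * ‖a - b‖)
    (a b : E) (ha : a ∈ s) (hb : b ∈ s)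
    (haMin : ∀ y ∈ s, G a ≤ G y)
    (hbMin : ∀ y ∈ s, G b + g b ≤ G y + g y) :
    ‖b - a‖ ≤ M / σ := by
  have hGs : StrongConvexOn s σ G := strongConvexOn_iff_convex.2 hG
  have hGgs : StrongConvexOn s σ (G + g) := by
    refine strongConvexOn_iff_convex.2 ((hG.add hg).congr fun y _ => ?_)
    simp only [Pi.add_apply]
    ring
  have h1 := hGs.quadratic_growth_of_isMinOn ha hb haMin
  have h2 := hGgs.quadratic_growth_of_isMinOn hb ha hbMin
  have h3 := (le_abs_self _).trans (hlip a ha b hb)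
  simp only [Pi.add_apply] at h2
  rw [norm_sub_rev a b] at h2 h3
  rw [le_div_iff₀ hσ]
  rcases (norm_nonneg (b - a)).eq_or_lt with h0 | h0
  · rwa [← h0, zero_mul]
  · refine le_of_mul_le_mul_right ?_ h0
    linarith
end

section
/- Let E be a real normed vector space, F ⊆ E a nonempty compact convex set, T a positive integer, and 1 ≤ t ≤ T. Let D = inf_{f∈F} sup_{f'∈F} ‖f − f'‖. Let x_1,…,x_{t−1} : F → ℝ be convex 1-Lipschitz functions. Then inf_{f₀∈F} sup { x(f₀) − inf_{f∈F} ( Σ_{i=1}^{t−1} x_i(f) + x(f) ) + (T−t)·D : x : F → ℝ convex and 1-Lipschitz } ≤ − inf_{f∈F} Σ_{i=1}^{t−1} x_i(f) + (T−t+1)·D. -/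
/-- The value `x(f₀) − inf_K (S + x)` of a 1-Lipschitz loss `x` exceeds `− inf_K S` by at most the
radius of `K` about `f₀`. -/
lemma sub_sInf_add_le_radius {E : Type*} [NormedAddCommGroup E] {K : Set E}
    (hK : Bornology.IsBounded K) {S g : E → ℝ} (hS : BddBelow (S '' K))
    (hg : ∀ a ∈ K, ∀ b ∈ K, |g a - g b| ≤ ‖a - b‖) {f₀ : E} (hf₀ : f₀ ∈ K) :
    g f₀ - sInf ((fun f => S f + g f) '' K)
      ≤ - sInf (S '' K) + sSup ((fun f' => ‖f₀ - f'‖) '' K) := by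
  have hbdd : BddAbove ((fun f' => ‖f₀ - f'‖) '' K) := by
    refine ⟨Metric.diam K, ?_⟩
    rintro _ ⟨f, hf, rfl⟩
    simpa only [dist_eq_norm] using Metric.dist_le_diam_of_mem hK hf₀ hf
  have h : sInf (S '' K) + g f₀ - sSup ((fun f' => ‖f₀ - f'‖) '' K)
      ≤ sInf ((fun f => S f + g f) '' K) := by
    refine le_csInf (Set.Nonempty.image _ ⟨f₀, hf₀⟩) ?_
    rintro _ ⟨f, hf, rfl⟩
    have hSf : sInf (S '' K) ≤ S f := csInf_le hS ⟨f, hf, rfl⟩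
    have hr : ‖f₀ - f‖ ≤ sSup ((fun f' => ‖f₀ - f'‖) '' K) := le_csSup hbdd ⟨f, hf, rfl⟩
    have hgf := (abs_le.mp (hg f₀ hf₀ f hf)).2
    dsimp only
    linarith
  linarith

/-- A finite sum of functions that are 1-Lipschitz on `K` is continuous on `K`. -/
lemma continuousOn_sum_of_abs_sub_le {ι E : Type*} [NormedAddCommGroup E] {K : Set E}
    (s : Finset ι) {xs : ι → E → ℝ}
    (hxs : ∀ i ∈ s, ∀ a ∈ K, ∀ b ∈ K, |xs i a - xs i b| ≤ ‖a - b‖) :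
    ContinuousOn (fun f => ∑ i ∈ s, xs i f) K := by
  refine continuousOn_finsetSum s fun i hi => ?_
  refine (LipschitzOnWith.of_dist_le_mul (K := 1) fun a ha b hb => ?_).continuousOn
  simpa [Real.dist_eq, dist_eq_norm] using hxs i hi a ha b hb

/-- admissibility of the relaxation for strongly convex / general convex
Lipschitz online optimization (Lemma 21): with `D = inf_{f∈K} sup_{f'∈K} ‖f − f'‖`,
`inf_{f₀∈K} sup_{x convex 1-Lipschitz} [x(f₀) − inf_{f∈K}(Σ_i x_i(f) + x(f)) + (T−t)D]
  ≤ − inf_{f∈K} Σ_i x_i(f) + (T−t+1)D`. -/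
theorem convex_relaxation_admissible
    {E : Type*} [NormedAddCommGroup E] [NormedSpace ℝ E]
    (K : Set E) (hKne : K.Nonempty) (hKcomp : IsCompact K) (hKconv : Convex ℝ K)
    (T t : ℕ) (ht1 : 1 ≤ t) (ht2 : t ≤ T)
    (xs : ℕ → E → ℝ)
    (hxs : ∀ i, i < t - 1 → ConvexOn ℝ K (xs i) ∧
      ∀ a ∈ K, ∀ b ∈ K, |xs i a - xs i b| ≤ ‖a - b‖) :
    sInf ((fun f₀ : E =>
        sSup {r : ℝ | ∃ g : E → ℝ, ConvexOn ℝ K g ∧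
          (∀ a ∈ K, ∀ b ∈ K, |g a - g b| ≤ ‖a - b‖) ∧
          r = g f₀
              - sInf ((fun f => (∑ i ∈ Finset.range (t - 1), xs i f) + g f) '' K)
              + ((T : ℝ) - t) *
                  sInf ((fun f => sSup ((fun f' => ‖f - f'‖) '' K)) '' K)}) '' K)
      ≤ - sInf ((fun f => ∑ i ∈ Finset.range (t - 1), xs i f) '' K)
        + ((T : ℝ) - t + 1) *
            sInf ((fun f => sSup ((fun f' => ‖f - f'‖) '' K)) '' K) := by
  set S : E → ℝ := fun f => ∑ i ∈ Finset.range (t - 1), xs i f with hS_def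
  set D : ℝ := sInf ((fun f => sSup ((fun f' => ‖f - f'‖) '' K)) '' K) with hD_def
  have hS : BddBelow (S '' K) := hKcomp.bddBelow_image <|
    continuousOn_sum_of_abs_sub_le _ fun i hi => (hxs i (Finset.mem_range.mp hi)).2
  have hub : ∀ f₀ ∈ K, ∀ r ∈ {r : ℝ | ∃ g : E → ℝ, ConvexOn ℝ K g ∧
      (∀ a ∈ K, ∀ b ∈ K, |g a - g b| ≤ ‖a - b‖) ∧
      r = g f₀ - sInf ((fun f => S f + g f) '' K) + ((T : ℝ) - t) * D},
      r ≤ - sInf (S '' K) + sSup ((fun f' => ‖f₀ - f'‖) '' K) + ((T : ℝ) - t) * D := by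
    rintro f₀ hf₀ _ ⟨g, -, hg, rfl⟩
    gcongr
    exact sub_sInf_add_le_radius hKcomp.isBounded hS hg hf₀
  have hzero : ∀ f₀ : E, - sInf (S '' K) + ((T : ℝ) - t) * D ∈ {r : ℝ | ∃ g : E → ℝ,
      ConvexOn ℝ K g ∧ (∀ a ∈ K, ∀ b ∈ K, |g a - g b| ≤ ‖a - b‖) ∧
      r = g f₀ - sInf ((fun f => S f + g f) '' K) + ((T : ℝ) - t) * D} :=
    fun f₀ => ⟨fun _ => 0, convexOn_const 0 hKconv, by simp, by simp⟩
  refine le_of_forall_pos_le_add fun ε hε => ?_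
  obtain ⟨_, ⟨f₀, hf₀, rfl⟩, hlt⟩ := exists_lt_of_csInf_lt (hKne.image _)
    (show sInf ((fun f => sSup ((fun f' => ‖f - f'‖) '' K)) '' K) < D + ε by linarith)
  refine csInf_le_of_le ⟨- sInf (S '' K) + ((T : ℝ) - t) * D, ?_⟩ ⟨f₀, hf₀, rfl⟩
    (csSup_le ⟨_, hzero f₀⟩ fun r hr => (hub f₀ hf₀ r hr).trans ?_)
  · rintro _ ⟨f, hf, rfl⟩
    exact le_csSup ⟨_, hub f hf⟩ (hzero f)
  · dsimp only at hlt
    linarith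
end

section
/- For every positive integer N and every w ∈ ℝ^N: max_{x ∈ {−1,1}^N} (1/2)·( max_{1≤i≤N} |w_i + 2 x_i| + max_{1≤i≤N} |w_i − 2 x_i| ) ≤ 2^{−N} Σ_{x ∈ {−1,1}^N} max_{1≤i≤N} |w_i + 6 x_i|. -/
/-- The cube `{−1,1}^ι`, encoded by `ι → Bool`, with the `i`-th coordinate reflected. -/
def flipCoord {ι : Type*} [DecidableEq ι] (i : ι) (x : ι → Bool) : ι → Bool :=
  Function.update x i (!x i)

theorem flipCoord_involutive {ι : Type*} [DecidableEq ι] (i : ι) :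
    Function.Involutive (flipCoord i) := by
  intro x
  simp [flipCoord]

theorem sum_flipCoord {ι : Type*} [Fintype ι] [DecidableEq ι] (i : ι) (F : (ι → Bool) → ℝ) :
    ∑ x, F (flipCoord i x) = ∑ x, F x :=
  Equiv.sum_comp (flipCoord_involutive i).toPerm F

theorem le_average_of_le_flipCoord {ι : Type*} [Fintype ι] [DecidableEq ι] (i j : ι)
    (F : (ι → Bool) → ℝ) (c : ℝ)
    (h : ∀ x, 4 * c ≤ F x + F (flipCoord i x) + F (flipCoord j x) +
      F (flipCoord j (flipCoord i x))) :
    c ≤ (2 : ℝ)⁻¹ ^ Fintype.card ι * ∑ x, F x := by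
  have hs := Finset.sum_le_sum fun x (_ : x ∈ Finset.univ) => h x
  simp only [Finset.sum_add_distrib, sum_flipCoord, Finset.sum_const, Finset.card_univ,
    nsmul_eq_mul, sum_flipCoord i fun x => F (flipCoord j x)] at hs
  rw [Fintype.card_fun, Fintype.card_bool] at hs
  push_cast at hs
  rw [inv_pow, inv_mul_eq_div, le_div_iff₀ (by positivity)]
  linarith

theorem abs_add_abs_le_average {ι : Type*} [Fintype ι] [DecidableEq ι] (w : ι → ℝ)
    (F : (ι → Bool) → ℝ)
    (hF : ∀ x k, |w k + 6 * (if x k then (1 : ℝ) else -1)| ≤ F x) (x : ι → Bool) (i j : ι) :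
    (1 / 2 : ℝ) * (|w i + 2 * (if x i then (1 : ℝ) else -1)| +
      |w j - 2 * (if x j then (1 : ℝ) else -1)|) ≤
      (2 : ℝ)⁻¹ ^ Fintype.card ι * ∑ y, F y := by
  obtain rfl | hij := eq_or_ne i j
  · refine le_average_of_le_flipCoord i i F _ fun y => ?_
    have h₁ := abs_le.1 (hF y i)
    have h₂ := abs_le.1 (hF (flipCoord i y) i)
    rw [flipCoord_involutive i y]
    generalize F y = F₁ at *
    generalize F (flipCoord i y) = F₂ at *
    simp only [flipCoord, Function.update_self] at h₂
    cases x i <;> cases hy : y i <;>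
      simp only [hy, Bool.not_true, Bool.not_false, if_true, Bool.false_eq_true, if_false] at h₁ h₂ ⊢ <;>
      rcases abs_cases (w i + 2 * 1) with h | h <;>
      rcases abs_cases (w i - 2 * 1) with h' | h' <;>
      simp only [mul_neg, sub_neg_eq_add, ← sub_eq_add_neg, h.1, h'.1] at h₁ h₂ ⊢ <;>
      linarith
  · refine le_average_of_le_flipCoord i j F _ fun y => ?_
    have hbound (a : ℝ) (b : Bool) : |a + 2 * (if b then (1 : ℝ) else -1)| ≤ |a| + 2 ∧
        |a - 2 * (if b then (1 : ℝ) else -1)| ≤ |a| + 2 := by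
      cases b <;> constructor <;>
        simp only [if_true, Bool.false_eq_true, if_false] <;> rw [abs_le] <;>
        constructor <;> linarith [neg_abs_le a, le_abs_self a]
    have hi := (hbound (w i) (x i)).1
    have hj := (hbound (w j) (x j)).2
    have hi₁ := abs_le.1 (hF y i)
    have hj₁ := abs_le.1 (hF y j)
    have hi₂ := abs_le.1 (hF (flipCoord i y) i)
    have hj₂ := abs_le.1 (hF (flipCoord i y) j)
    have hi₃ := abs_le.1 (hF (flipCoord j y) i)
    have hj₃ := abs_le.1 (hF (flipCoord j y) j)
    have hi₄ := abs_le.1 (hF (flipCoord j (flipCoord i y)) i)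
    have hj₄ := abs_le.1 (hF (flipCoord j (flipCoord i y)) j)
    generalize F y = F₁ at *
    generalize F (flipCoord i y) = F₂ at *
    generalize F (flipCoord j y) = F₃ at *
    generalize F (flipCoord j (flipCoord i y)) = F₄ at *
    simp only [flipCoord, Function.update_self, Function.update_of_ne hij,
      Function.update_of_ne hij.symm] at hi₂ hj₂ hi₃ hj₃ hi₄ hj₄
    cases hyi : y i <;> cases hyj : y j <;>
      simp only [hyi, hyj, Bool.not_true, Bool.not_false, if_true, Bool.false_eq_true, if_false]
        at hi₁ hj₁ hi₂ hj₂ hi₃ hj₃ hi₄ hj₄ <;>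
      rcases abs_cases (w i) with h | h <;>
      rcases abs_cases (w j) with h' | h' <;>
      linarith


/-- Lemma 6 of the paper: the uniform distribution on the vertices of
the cube `{−1,1}^N` satisfies the perturbation assumption for `ℓ1/ℓ∞` online linear
optimization with constant `C = 6`:
`max_{x∈{−1,1}^N} E_ε max_i |w_i + 2εx_i| ≤ E_{x} E_ε max_i |w_i + 6εx_i|`. -/
theorem cube_perturbation_assumption
    (N : ℕ) (hN : 0 < N) (w : Fin N → ℝ) :
    Finset.univ.sup' Finset.univ_nonempty (fun x : Fin N → Bool =>
      (1 / 2 : ℝ) *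
        (Finset.univ.sup' (⟨⟨0, hN⟩, Finset.mem_univ _⟩ : (Finset.univ : Finset (Fin N)).Nonempty)
            (fun i => |w i + 2 * (if x i then (1 : ℝ) else -1)|)
          + Finset.univ.sup' (⟨⟨0, hN⟩, Finset.mem_univ _⟩ : (Finset.univ : Finset (Fin N)).Nonempty)
            (fun i => |w i - 2 * (if x i then (1 : ℝ) else -1)|)))
      ≤ (2 : ℝ)⁻¹ ^ N *
          ∑ x : Fin N → Bool,
            Finset.univ.sup' (⟨⟨0, hN⟩, Finset.mem_univ _⟩ : (Finset.univ : Finset (Fin N)).Nonempty)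
              (fun i => |w i + 6 * (if x i then (1 : ℝ) else -1)|) := by
  refine Finset.sup'_le _ _ fun x _ => ?_
  obtain ⟨i, -, hi⟩ := Finset.exists_mem_eq_sup' (⟨⟨0, hN⟩, Finset.mem_univ _⟩ :
    (Finset.univ : Finset (Fin N)).Nonempty) fun i => |w i + 2 * (if x i then (1 : ℝ) else -1)|
  obtain ⟨j, -, hj⟩ := Finset.exists_mem_eq_sup' (⟨⟨0, hN⟩, Finset.mem_univ _⟩ :
    (Finset.univ : Finset (Fin N)).Nonempty) fun i => |w i - 2 * (if x i then (1 : ℝ) else -1)|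
  rw [hi, hj]
  simpa only [Fintype.card_fin] using abs_add_abs_le_average w _
    (fun y k => Finset.le_sup' (fun k => |w k + 6 * (if y k then (1 : ℝ) else -1)|)
      (Finset.mem_univ k)) x i j
end

section
/- Let N be a positive integer and μ a Borel probability measure on ℝ that is symmetric (the pushforward of μ under x ↦ −x equals μ) and such that the identity is μ-integrable with m := ∫_ℝ |x| dμ(x) > 0. Let C be a real number with C ≥ 6/m. Then for every w ∈ ℝ^N: max_{x ∈ {−1,1}^N} (1/2)·( max_{1≤i≤N} |w_i + 2 x_i| + max_{1≤i≤N} |w_i − 2 x_i| ) ≤ ∫ max_{1≤i≤N} |w_i + C y_i| dμ^{⊗N}(y), where μ^{⊗N} denotes the N-fold product measure on ℝ^N. -/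
open MeasureTheory

/-- Negate the coordinates of `y` that lie in `s`. -/
def flipSigns {ι : Type*} [DecidableEq ι] (s : Finset ι) (y : ι → ℝ) : ι → ℝ :=
  fun i => if i ∈ s then -y i else y i

lemma measurePreserving_flipSigns {ι : Type*} [Fintype ι] [DecidableEq ι] (μ : Measure ℝ)
    [IsProbabilityMeasure μ] (hsymm : μ.map (fun x => -x) = μ) (s : Finset ι) :
    MeasurePreserving (flipSigns s) (Measure.pi fun _ : ι => μ) (Measure.pi fun _ : ι => μ) := by
  refine measurePreserving_pi (f := fun i x => if i ∈ s then -x else x) _ _ fun i => ?_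
  by_cases h : i ∈ s
  · simpa [h] using (⟨measurable_neg, hsymm⟩ : MeasurePreserving (fun x : ℝ => -x) μ μ)
  · simp only [h, if_false]
    exact MeasurePreserving.id μ

lemma MeasureTheory.MeasurePreserving.integral_comp_of_integrable {α : Type*} [MeasurableSpace α]
    {ν : Measure α} {T : α → α} (hT : MeasurePreserving T ν ν) {G : α → ℝ}
    (hG : Integrable G ν) : ∫ y, G (T y) ∂ν = ∫ y, G y ∂ν := by
  have h : AEStronglyMeasurable G (ν.map T) := by rw [hT.map_eq]; exact hG.1
  rw [← integral_map hT.aemeasurable h, hT.map_eq]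

lemma integrable_sup'_abs_add_mul {ι : Type*} [Fintype ι] (μ : Measure ℝ)
    [IsProbabilityMeasure μ] (hint : Integrable (fun x : ℝ => x) μ)
    (h : (Finset.univ : Finset ι).Nonempty) (C : ℝ) (w : ι → ℝ) :
    Integrable (fun y : ι → ℝ => Finset.univ.sup' h fun i => |w i + C * y i|)
      (Measure.pi fun _ : ι => μ) := by
  have hcoord (i : ι) : Integrable (fun y : ι → ℝ => |w i + C * y i|)
      (Measure.pi fun _ : ι => μ) :=
    ((integrable_const (w i)).add
      ((integrable_comp_eval (μ := fun _ : ι => μ) (i := i) (f := fun x => x) hint).const_mul C)).abs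
  refine (integrable_finsetSum Finset.univ fun i _ => hcoord i).mono' ?_ ?_
  · refine Measurable.aestronglyMeasurable ?_
    have := Finset.measurable_sup' h (f := fun i (y : ι → ℝ) => |w i + C * y i|)
      (fun i _ => by fun_prop)
    convert this using 2 with y
    rw [Finset.sup'_apply]
  · refine ae_of_all _ fun y => ?_
    obtain ⟨i, hi⟩ := h
    rw [Real.norm_of_nonneg ((abs_nonneg _).trans
      (Finset.le_sup' (fun i => |w i + C * y i|) hi))]
    exact Finset.sup'_le _ _ fun k hk =>
      Finset.single_le_sum (f := fun k => |w k + C * y k|) (fun _ _ => abs_nonneg _) hk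

/-- If `m₁, …, m₄` dominate the four sign choices of `(a ± u, b ± v)` coordinatewise in absolute
value, then their average is at least `(|a| + |b| + |u|) / 2`. -/
lemma abs_add_le_sum_of_sign_choices {a b u v m₁ m₂ m₃ m₄ : ℝ}
    (h₁ : |a + u| ≤ m₁ ∧ |b + v| ≤ m₁) (h₂ : |a + u| ≤ m₂ ∧ |b - v| ≤ m₂)
    (h₃ : |a - u| ≤ m₃ ∧ |b + v| ≤ m₃) (h₄ : |a - u| ≤ m₄ ∧ |b - v| ≤ m₄) :
    2 * |a| + 2 * |b| + 2 * |u| ≤ m₁ + m₂ + m₃ + m₄ := by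
  have hb : 2 * |b| ≤ |b + v| + |b - v| := by
    have := abs_add_le (b + v) (b - v)
    rwa [show b + v + (b - v) = 2 * b by ring, abs_mul, abs_two] at this
  have ha : |a| + |u| ≤ |a + u| ∨ |a| + |u| ≤ |a - u| := by
    rcases abs_cases a with h | h <;> rcases abs_cases u with h' | h' <;>
      first
      | left; linarith [le_abs_self (a + u), neg_abs_le (a + u)]
      | right; linarith [le_abs_self (a - u), neg_abs_le (a - u)]
  rcases ha with ha | ha <;> linarith [h₁.1, h₁.2, h₂.1, h₂.2, h₃.1, h₃.2, h₄.1, h₄.2]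

lemma abs_add_add_abs_sub_le (a t : ℝ) : |a + t| + |a - t| ≤ 2 * max |a| |t| := by
  have ha := abs_le.1 (le_max_left |a| |t|)
  have ht := abs_le.1 (le_max_right |a| |t|)
  rcases abs_cases (a + t) with h | h <;> rcases abs_cases (a - t) with h' | h' <;> linarith

/-- If `G` dominates every coordinate of `|w + C • y|`, where `y` has independent symmetric
coordinates, then its mean is at least `(|w i| + |w j| + |C| * 𝔼|y i|) / 2`. -/
lemma le_integral_of_ne {ι : Type*} [Fintype ι] [DecidableEq ι] (μ : Measure ℝ)
    [IsProbabilityMeasure μ] (hsymm : μ.map (fun x => -x) = μ)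
    (hint : Integrable (fun x : ℝ => x) μ) (C : ℝ) (w : ι → ℝ) {G : (ι → ℝ) → ℝ}
    (hG : Integrable G (Measure.pi fun _ : ι => μ)) (hle : ∀ y i, |w i + C * y i| ≤ G y)
    {i j : ι} (hij : i ≠ j) :
    2 * |w i| + 2 * |w j| + 2 * (|C| * ∫ x, |x| ∂μ) ≤ 4 * ∫ y, G y ∂(Measure.pi fun _ => μ) := by
  have hT := measurePreserving_flipSigns (ι := ι) μ hsymm
  have hGT (s : Finset ι) : Integrable (fun y => G (flipSigns s y)) (Measure.pi fun _ => μ) :=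
    (hT s).integrable_comp_of_integrable hG
  have hy : Integrable (fun y : ι → ℝ => |y i|) (Measure.pi fun _ => μ) :=
    integrable_comp_eval (i := i) hint.abs
  have hG₂ : Integrable (fun y => G y + G (flipSigns {j} y)) (Measure.pi fun _ => μ) :=
    hG.add (hGT _)
  have hG₃ : Integrable (fun y => G y + G (flipSigns {j} y) + G (flipSigns {i} y))
      (Measure.pi fun _ => μ) :=
    hG₂.add (hGT _)
  have hmono : ∫ y : ι → ℝ, (2 * |w i| + 2 * |w j| + 2 * (|C| * |y i|)) ∂(Measure.pi fun _ => μ)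
      ≤ ∫ y, (G y + G (flipSigns {j} y) + G (flipSigns {i} y) + G (flipSigns {i, j} y))
        ∂(Measure.pi fun _ => μ) := by
    refine integral_mono ((integrable_const _).add ((hy.const_mul _).const_mul _))
      (hG₃.add (hGT _)) fun y => ?_
    have key (s : Finset ι) : |w i + C * flipSigns s y i| ≤ G (flipSigns s y) ∧
        |w j + C * flipSigns s y j| ≤ G (flipSigns s y) := ⟨hle _ _, hle _ _⟩
    have h₂ := key {j}
    have h₃ := key {i}
    have h₄ := key {i, j}
    simp only [flipSigns, Finset.mem_singleton, Finset.mem_insert, hij, hij.symm, if_true,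
      if_false, or_true, or_false, mul_neg, ← sub_eq_add_neg] at h₂ h₃ h₄
    simp only [← abs_mul]
    exact abs_add_le_sum_of_sign_choices ⟨hle y i, hle y j⟩ h₂ h₃ h₄
  rw [integral_add (by fun_prop) ((hy.const_mul _).const_mul _), integral_const,
    integral_const_mul, integral_const_mul,
    integral_comp_eval (μ := fun _ : ι => μ) (i := i) (f := fun x : ℝ => |x|) hint.abs.1,
    integral_add hG₃ (hGT _), integral_add hG₂ (hGT _),
    integral_add hG (hGT _), (hT _).integral_comp_of_integrable hG,
    (hT _).integral_comp_of_integrable hG, (hT _).integral_comp_of_integrable hG] at hmono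
  simp only [probReal_univ, one_smul] at hmono
  linarith

lemma max_le_integral {ι : Type*} [Fintype ι] [DecidableEq ι] (μ : Measure ℝ)
    [IsProbabilityMeasure μ] (hsymm : μ.map (fun x => -x) = μ)
    (hint : Integrable (fun x : ℝ => x) μ) (C : ℝ) (w : ι → ℝ) {G : (ι → ℝ) → ℝ}
    (hG : Integrable G (Measure.pi fun _ : ι => μ)) (hle : ∀ y i, |w i + C * y i| ≤ G y) (i : ι) :
    max |w i| (|C| * ∫ x, |x| ∂μ) ≤ ∫ y, G y ∂(Measure.pi fun _ => μ) := by
  have hT := measurePreserving_flipSigns (ι := ι) μ hsymm {i}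
  have hGT : Integrable (fun y => G (flipSigns {i} y)) (Measure.pi fun _ => μ) :=
    hT.integrable_comp_of_integrable hG
  have hy : Integrable (fun y : ι → ℝ => |y i|) (Measure.pi fun _ => μ) :=
    integrable_comp_eval (i := i) hint.abs
  have hpt (y : ι → ℝ) : max |w i| (|C| * |y i|) ≤ (G y + G (flipSigns {i} y)) / 2 := by
    have h₁ := hle y i
    have h₂ := hle (flipSigns {i} y) i
    simp only [flipSigns, Finset.mem_singleton, if_true, mul_neg] at h₂
    rw [← abs_mul]
    rw [abs_le] at h₁ h₂
    exact max_le (abs_le.2 ⟨by linarith, by linarith⟩) (abs_le.2 ⟨by linarith, by linarith⟩)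
  have havg : ∫ y, (G y + G (flipSigns {i} y)) / 2 ∂(Measure.pi fun _ => μ)
      = ∫ y, G y ∂(Measure.pi fun _ => μ) := by
    rw [integral_div, integral_add hG hGT, hT.integral_comp_of_integrable hG]
    ring
  rw [← havg]
  refine max_le ?_ ?_
  · simpa using integral_mono (integrable_const |w i|) ((hG.add hGT).div_const 2)
      fun y => (le_max_left _ _).trans (hpt y)
  · have := integral_mono (hy.const_mul |C|) ((hG.add hGT).div_const 2)
      fun y => (le_max_right _ _).trans (hpt y)
    rwa [integral_const_mul,
      integral_comp_eval (μ := fun _ : ι => μ) (i := i) (f := fun x : ℝ => |x|) hint.abs.1] at this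

open MeasureTheory

/-- Lemma 7 of the paper: any symmetric distribution `μ` on the real
line with positive mean absolute value `m = E|x| > 0`, used coordinatewise as a
perturbation, satisfies the `ℓ1/ℓ∞` perturbation assumption with any constant
`C ≥ 6/m`:
`max_{x∈{−1,1}^N} E_ε max_i |w_i + 2εx_i| ≤ E_{y∼μ^{⊗N}} max_i |w_i + C y_i|`. -/
theorem symmetric_perturbation_assumption
    (N : ℕ) (hN : 0 < N) (μ : Measure ℝ) [IsProbabilityMeasure μ]
    (hsymm : μ.map (fun x => -x) = μ)
    (hint : Integrable (fun x : ℝ => x) μ)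
    (hm : 0 < ∫ x, |x| ∂μ)
    (C : ℝ) (hC : 6 / (∫ x, |x| ∂μ) ≤ C)
    (w : Fin N → ℝ) :
    Finset.univ.sup' Finset.univ_nonempty (fun x : Fin N → Bool =>
      (1 / 2 : ℝ) *
        (Finset.univ.sup' (⟨⟨0, hN⟩, Finset.mem_univ _⟩ : (Finset.univ : Finset (Fin N)).Nonempty)
            (fun i => |w i + 2 * (if x i then (1 : ℝ) else -1)|)
          + Finset.univ.sup' (⟨⟨0, hN⟩, Finset.mem_univ _⟩ : (Finset.univ : Finset (Fin N)).Nonempty)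
            (fun i => |w i - 2 * (if x i then (1 : ℝ) else -1)|)))
      ≤ ∫ y : Fin N → ℝ,
          Finset.univ.sup' (⟨⟨0, hN⟩, Finset.mem_univ _⟩ : (Finset.univ : Finset (Fin N)).Nonempty)
            (fun i => |w i + C * y i|)
          ∂(Measure.pi fun _ : Fin N => μ) := by
  classical
  have hne : (Finset.univ : Finset (Fin N)).Nonempty := ⟨⟨0, hN⟩, Finset.mem_univ _⟩
  have hG := integrable_sup'_abs_add_mul μ hint hne C w
  have hle (y : Fin N → ℝ) (i : Fin N) :
      |w i + C * y i| ≤ Finset.univ.sup' hne fun i => |w i + C * y i| :=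
    Finset.le_sup' (fun i => |w i + C * y i|) (Finset.mem_univ i)
  have hCm : 6 ≤ |C| * ∫ x, |x| ∂μ :=
    ((div_le_iff₀ hm).1 hC).trans (mul_le_mul_of_nonneg_right (le_abs_self C) hm.le)
  refine Finset.sup'_le _ _ fun x _ => ?_
  obtain ⟨i, -, hi⟩ := Finset.exists_mem_eq_sup' hne
    fun i => |w i + 2 * (if x i then (1 : ℝ) else -1)|
  obtain ⟨j, -, hj⟩ := Finset.exists_mem_eq_sup' hne
    fun i => |w i - 2 * (if x i then (1 : ℝ) else -1)|
  rw [hi, hj]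
  have habs (k : Fin N) : |2 * (if x k then (1 : ℝ) else -1)| = 2 := by
    split_ifs <;> norm_num
  by_cases hij : i = j
  · subst hij
    have h := max_le_integral μ hsymm hint C w hG hle i
    refine le_trans ?_ ((max_le_max_left _ (by linarith : (2 : ℝ) ≤ _)).trans h)
    have h₁ := abs_add_add_abs_sub_le (w i) (2 * (if x i then (1 : ℝ) else -1))
    rw [habs] at h₁
    linarith
  · have h := le_integral_of_ne μ hsymm hint C w hG hle hij
    have h₁ := abs_add_le (w i) (2 * (if x i then (1 : ℝ) else -1))
    have h₂ := abs_sub (w j) (2 * (if x j then (1 : ℝ) else -1))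
    rw [habs] at h₁ h₂
    linarith
end

section
/- Let n ≥ 2 and let E = ℝ^n with the Euclidean inner product and norm. Let μ be a Borel probability measure on E concentrated on the unit sphere S = {x ∈ E : ‖x‖ = 1} (i.e., μ(S) = 1) and invariant under every linear isometric equivalence of E (the pushforward of μ under every orthogonal transformation equals μ). Then for every w ∈ E: (i) for every x ∈ E with ‖x‖ ≤ 1, (1/2)·( ‖w + 2x‖ + ‖w − 2x‖ ) ≤ √(‖w‖² + 4); and (ii) √(‖w‖² + 4) ≤ ∫_E ‖ w + 4√2 · y ‖ dμ(y). -/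
open MeasureTheory

theorem polynomial_le_sqrt_one_add_add_sqrt_one_sub {u : ℝ} (hu : u ^ 2 ≤ 1) :
    2 * (1 - u ^ 2 / 8 - 3 / 16 * (u ^ 2) ^ 2) ≤ √(1 + u) + √(1 - u) := by
  have habs := abs_le.mp ((sq_le_one_iff_abs_le_one u).mp hu)
  have h1 : 0 ≤ 1 + u := by linarith
  have h2 : 0 ≤ 1 - u := by linarith
  have hprod : √(1 + u) * √(1 - u) = √(1 - u ^ 2) := by
    rw [← Real.sqrt_mul h1]
    ring_nf
  have hv0 := sq_nonneg u
  generalize u ^ 2 = v at *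
  have hs : (1 - v) * (1 + v / 2) ≤ √(1 - v) := by
    apply Real.le_sqrt_of_sq_le
    have h : (1 - v) * (1 + v / 2) ^ 2 ≤ 1 := by nlinarith [pow_nonneg hv0 2, pow_nonneg hv0 3]
    nlinarith [mul_le_mul_of_nonneg_left h (sub_nonneg.mpr hu)]
  refine le_of_abs_le (abs_le_of_sq_le_sq ?_ (by positivity))
  have e1 := Real.sq_sqrt h1
  have e2 := Real.sq_sqrt h2
  have hp : 2 * (1 - v / 8 - 3 / 16 * v ^ 2) ^ 2 - 1 ≤ (1 - v) * (1 + v / 2) := by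
    have h3 : v ^ 3 ≤ v ^ 2 := pow_le_pow_of_le_one hv0 hu (by norm_num)
    have h4 : v ^ 4 ≤ v ^ 2 := pow_le_pow_of_le_one hv0 hu (by norm_num)
    nlinarith [pow_nonneg hv0 2]
  nlinarith

theorem polynomial_le_sqrt_add_add_sqrt_sub {A B : ℝ} (hA : 0 < A) (h : (B / A) ^ 2 ≤ 1) :
    √A * (2 * (1 - (B / A) ^ 2 / 8 - 3 / 16 * ((B / A) ^ 2) ^ 2)) ≤ √(A + B) + √(A - B) := by
  have e1 : A + B = A * (1 + B / A) := by field_simp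
  have e2 : A - B = A * (1 - B / A) := by field_simp
  rw [e1, e2, Real.sqrt_mul hA.le, Real.sqrt_mul hA.le, ← mul_add]
  exact mul_le_mul_of_nonneg_left (polynomial_le_sqrt_one_add_add_sqrt_one_sub h)
    (Real.sqrt_nonneg A)

theorem integrable_of_continuous_of_bound {E : Type*} [NormedAddCommGroup E]
    [MeasurableSpace E] [BorelSpace E] [SecondCountableTopology E]
    {μ : Measure E} [IsFiniteMeasure μ] (hμ : ∀ᵐ y ∂μ, ‖y‖ = 1) {f : E → ℝ} (hf : Continuous f) (C : ℝ)
    (hC : ∀ y, ‖y‖ = 1 → |f y| ≤ C) : Integrable f μ :=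
  Integrable.of_bound hf.aestronglyMeasurable C (hμ.mono hC)

section InnerProductSpace

variable {E : Type*} [NormedAddCommGroup E] [InnerProductSpace ℝ E]

theorem norm_add_add_norm_sub_le (w z : E) :
    ‖w + z‖ + ‖w - z‖ ≤ 2 * √(‖w‖ ^ 2 + ‖z‖ ^ 2) := by
  have h := parallelogram_law_with_norm ℝ w z
  have hs := Real.sq_sqrt (show 0 ≤ ‖w‖ ^ 2 + ‖z‖ ^ 2 by positivity)
  refine le_of_abs_le (abs_le_of_sq_le_sq ?_ (by positivity))
  nlinarith [sq_nonneg (‖w + z‖ - ‖w - z‖)]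

theorem norm_add_eq_sqrt (w z : E) :
    ‖w + z‖ = √(‖w‖ ^ 2 + ‖z‖ ^ 2 + 2 * inner ℝ w z) := by
  rw [← Real.sqrt_sq (norm_nonneg (w + z)), norm_add_sq_real]
  ring_nf

theorem inner_sq_add_inner_sq_le {w v : E} (hn : ‖v‖ = ‖w‖) (ho : inner ℝ w v = 0) (y : E) :
    inner ℝ w y ^ 2 + inner ℝ v y ^ 2 ≤ ‖w‖ ^ 2 * ‖y‖ ^ 2 := by
  set a : ℝ := inner ℝ w y
  set b : ℝ := inner ℝ v y
  have hz : ‖a • w + b • v‖ ^ 2 = (a ^ 2 + b ^ 2) * ‖w‖ ^ 2 := by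
    rw [norm_add_sq_real, norm_smul, norm_smul, inner_smul_left, inner_smul_right, ho, hn,
      mul_pow, mul_pow, Real.norm_eq_abs, Real.norm_eq_abs, sq_abs, sq_abs]
    ring
  have hi : inner ℝ (a • w + b • v) y = a ^ 2 + b ^ 2 := by
    rw [inner_add_left, real_inner_smul_left, real_inner_smul_left]
    ring
  have hcs := real_inner_mul_inner_self_le (a • w + b • v) y
  rw [hi, real_inner_self_eq_norm_sq, real_inner_self_eq_norm_sq, hz] at hcs
  by_contra! hlt
  have hpos : 0 < a ^ 2 + b ^ 2 := lt_of_le_of_lt (by positivity) hlt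
  nlinarith [mul_lt_mul_of_pos_left hlt hpos]

theorem exists_norm_eq_inner_eq_zero [FiniteDimensional ℝ E] (hE : 2 ≤ Module.finrank ℝ E)
    (w : E) : ∃ v : E, ‖v‖ = ‖w‖ ∧ inner ℝ w v = 0 := by
  have hne : (ℝ ∙ w)ᗮ ≠ ⊥ := by
    intro hbot
    rw [Submodule.orthogonal_eq_bot_iff] at hbot
    have h1 := finrank_span_le_card (R := ℝ) ({w} : Set E)
    rw [hbot, finrank_top] at h1
    simp at h1
    omega
  obtain ⟨z, hz, hz0⟩ := Submodule.exists_mem_ne_zero_of_ne_bot hne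
  rw [Submodule.mem_orthogonal_singleton_iff_inner_right] at hz
  refine ⟨(‖w‖ / ‖z‖) • z, ?_, by rw [inner_smul_right, hz, mul_zero]⟩
  rw [norm_smul, Real.norm_of_nonneg (by positivity)]
  exact div_mul_cancel₀ _ (norm_ne_zero_iff.mpr hz0)

theorem abs_inner_sq_le (w : E) {y : E} (hy : ‖y‖ = 1) :
    |inner ℝ w y ^ 2| ≤ ‖w‖ ^ 2 := by
  rw [abs_pow]
  gcongr
  simpa [hy] using abs_real_inner_le_norm w y

theorem le_norm_add_add_norm_sub (w : E) {y : E} (hy : ‖y‖ = 1) {c : ℝ} (hc : c ^ 2 = 32) :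
    √(‖w‖ ^ 2 + 32) * (2 - (1 / 4 + 48 * ‖w‖ ^ 2 / (‖w‖ ^ 2 + 32) ^ 2) *
      (128 / (‖w‖ ^ 2 + 32) ^ 2) * inner ℝ w y ^ 2) ≤ ‖w + c • y‖ + ‖w + c • (-y)‖ := by
  set A := ‖w‖ ^ 2 + 32 with hA
  have hA0 : 0 < A := by positivity
  have hyn : ‖c • y‖ ^ 2 = 32 := by
    rw [norm_smul, hy, mul_one, Real.norm_eq_abs, sq_abs, hc]
  have hin : inner ℝ w y ^ 2 ≤ ‖w‖ ^ 2 := (le_abs_self _).trans (abs_inner_sq_le w hy)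
  have hB : (2 * (c * inner ℝ w y) / A) ^ 2 = 128 / A ^ 2 * inner ℝ w y ^ 2 := by
    rw [div_pow, mul_pow, mul_pow, hc]
    ring
  have hU : 128 / A ^ 2 * inner ℝ w y ^ 2 ≤ 128 / A ^ 2 * ‖w‖ ^ 2 := by gcongr
  have hU1 : 128 / A ^ 2 * ‖w‖ ^ 2 ≤ 1 := by
    rw [div_mul_eq_mul_div, div_le_one (by positivity)]
    nlinarith [sq_nonneg (‖w‖ ^ 2 - 32)]
  have key := polynomial_le_sqrt_add_add_sqrt_sub hA0 (hB.trans_le (hU.trans hU1))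
  rw [smul_neg, norm_add_eq_sqrt, norm_add_eq_sqrt w (-(c • y)), norm_neg, inner_neg_right,
    real_inner_smul_right, hyn, ← hA, mul_neg, ← sub_eq_add_neg]
  refine le_trans (mul_le_mul_of_nonneg_left ?_ (Real.sqrt_nonneg A)) key
  rw [hB]
  have hmul := mul_le_mul_of_nonneg_right hU
    (show 0 ≤ 128 / A ^ 2 * inner ℝ w y ^ 2 by positivity)
  have e : 48 * ‖w‖ ^ 2 / A ^ 2 = 3 / 8 * (128 / A ^ 2 * ‖w‖ ^ 2) := by ring
  rw [e]
  linarith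

variable [MeasurableSpace E] [BorelSpace E]

theorem integral_comp_linearIsometryEquiv {μ : Measure E}
    (hinv : ∀ T : E ≃ₗᵢ[ℝ] E, μ.map ⇑T = μ) (T : E ≃ₗᵢ[ℝ] E) (f : E → ℝ) :
    ∫ y, f (T y) ∂μ = ∫ y, f y ∂μ := by
  have h := T.toHomeomorph.measurableEmbedding.integral_map (μ := μ) f
  rw [LinearIsometryEquiv.coe_toHomeomorph, hinv T] at h
  exact h.symm

theorem integral_inner_sq_le [FiniteDimensional ℝ E] (hE : 2 ≤ Module.finrank ℝ E)
    {μ : Measure E} [IsProbabilityMeasure μ] (hμ : ∀ᵐ y ∂μ, ‖y‖ = 1)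
    (hinv : ∀ T : E ≃ₗᵢ[ℝ] E, μ.map ⇑T = μ) (w : E) :
    ∫ y, (inner ℝ w y : ℝ) ^ 2 ∂μ ≤ ‖w‖ ^ 2 / 2 := by
  obtain ⟨v, hn, ho⟩ := exists_norm_eq_inner_eq_zero hE w
  have hint (x : E) : Integrable (fun y ↦ (inner ℝ x y : ℝ) ^ 2) μ :=
    integrable_of_continuous_of_bound hμ (by fun_prop) (‖x‖ ^ 2) fun y hy ↦ abs_inner_sq_le x hy
  have hswap : ∫ y, (inner ℝ v y : ℝ) ^ 2 ∂μ = ∫ y, (inner ℝ w y : ℝ) ^ 2 ∂μ := by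
    let T := (ℝ ∙ (v - w))ᗮ.reflection
    have hT : T v = w := Submodule.reflection_sub hn
    rw [← integral_comp_linearIsometryEquiv hinv T (fun y ↦ (inner ℝ w y : ℝ) ^ 2)]
    congr 1 with y
    rw [← hT, T.inner_map_map]
  have hsum : ∫ y, ((inner ℝ w y : ℝ) ^ 2 + inner ℝ v y ^ 2) ∂μ ≤ ∫ _, ‖w‖ ^ 2 ∂μ := by
    apply integral_mono_ae ((hint w).add (hint v)) (integrable_const _)
    filter_upwards [hμ] with y hy
    simpa [hy] using inner_sq_add_inner_sq_le hn ho y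
  rw [integral_add (hint w) (hint v), hswap] at hsum
  simp at hsum
  linarith

end InnerProductSpace

theorem sqrt_add_four_le {q : ℝ} (hq : 0 ≤ q) :
    2 * √(q + 4) ≤ √(q + 32) *
      (2 - (1 / 4 + 48 * q / (q + 32) ^ 2) * (128 / (q + 32) ^ 2) * (q / 2)) := by
  have hA0 : 0 < q + 32 := by positivity
  have h1 : √(q + 4) ≤ √(q + 32) * (1 - 14 / (q + 32)) := by
    have hnn : 0 ≤ 1 - 14 / (q + 32) := by
      rw [sub_nonneg, div_le_one hA0]
      linarith
    apply Real.sqrt_le_iff.mpr ⟨by positivity, ?_⟩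
    rw [mul_pow, Real.sq_sqrt hA0.le]
    have e : (q + 32) * (1 - 14 / (q + 32)) ^ 2 = q + 4 + 196 / (q + 32) := by
      field_simp
      ring
    rw [e]
    linarith [show 0 ≤ 196 / (q + 32) by positivity]
  have h2 : (1 / 4 + 48 * q / (q + 32) ^ 2) * (128 / (q + 32) ^ 2) * (q / 2) ≤
      2 * (14 / (q + 32)) := by
    have e : 2 * (14 / (q + 32)) -
        (1 / 4 + 48 * q / (q + 32) ^ 2) * (128 / (q + 32) ^ 2) * (q / 2) =
        (28 * (q + 32) ^ 3 - 16 * q * (q + 32) ^ 2 - 3072 * q ^ 2) / (q + 32) ^ 4 := by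
      field_simp
      ring
    rw [← sub_nonneg, e]
    apply div_nonneg _ (by positivity)
    nlinarith [mul_nonneg hq (sq_nonneg (q - 64))]
  nlinarith [mul_le_mul_of_nonneg_left h2 (Real.sqrt_nonneg (q + 32))]

/-- Lemma 9 of the paper: in `ℝ^n` (n ≥ 2), for the rotation-invariant
probability measure `μ` on the unit sphere and every `w`:
(i) `(1/2)(‖w + 2x‖ + ‖w − 2x‖) ≤ √(‖w‖² + 4)` for every `x` in the unit ball, and
(ii) `√(‖w‖² + 4) ≤ E_{y∼μ} ‖w + 4√2 · y‖`. -/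
theorem sphere_perturbation_assumption
    (n : ℕ) (hn : 2 ≤ n)
    (μ : Measure (EuclideanSpace ℝ (Fin n))) [IsProbabilityMeasure μ]
    (hsph : μ (Metric.sphere (0 : EuclideanSpace ℝ (Fin n)) 1) = 1)
    (hinv : ∀ T : EuclideanSpace ℝ (Fin n) ≃ₗᵢ[ℝ] EuclideanSpace ℝ (Fin n),
      μ.map ⇑T = μ)
    (w : EuclideanSpace ℝ (Fin n)) :
    (∀ x : EuclideanSpace ℝ (Fin n), ‖x‖ ≤ 1 →
      (1 / 2 : ℝ) * (‖w + (2 : ℝ) • x‖ + ‖w - (2 : ℝ) • x‖)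
        ≤ Real.sqrt (‖w‖ ^ 2 + 4)) ∧
    Real.sqrt (‖w‖ ^ 2 + 4) ≤ ∫ y, ‖w + (4 * Real.sqrt 2) • y‖ ∂μ := by
  have hμ : ∀ᵐ y ∂μ, ‖y‖ = 1 := by
    have h := (prob_compl_eq_zero_iff Metric.isClosed_sphere.measurableSet).mpr hsph
    filter_upwards [measure_eq_zero_iff_ae_notMem.mp h] with y hy
    simpa using hy
  constructor
  · intro x hx
    have h := norm_add_add_norm_sub_le w ((2 : ℝ) • x)
    have hle : √(‖w‖ ^ 2 + ‖(2 : ℝ) • x‖ ^ 2) ≤ √(‖w‖ ^ 2 + 4) := by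
      apply Real.sqrt_le_sqrt
      rw [norm_smul, Real.norm_ofNat]
      nlinarith [norm_nonneg x]
    linarith
  · set c : ℝ := 4 * √2
    have hc : c ^ 2 = 32 := by
      rw [mul_pow, Real.sq_sqrt (by norm_num)]
      norm_num
    have hbound (y : EuclideanSpace ℝ (Fin n)) (hy : ‖y‖ = 1) : ‖w + c • y‖ ≤ ‖w‖ + |c| := by
      simpa [norm_smul, hy] using norm_add_le w (c • y)
    have hf : Integrable (fun y ↦ ‖w + c • y‖) μ :=
      integrable_of_continuous_of_bound hμ (by fun_prop) (‖w‖ + |c|) fun y hy ↦ by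
        simpa using hbound y hy
    have hg : Integrable (fun y ↦ ‖w + c • (-y)‖) μ :=
      integrable_of_continuous_of_bound hμ (by fun_prop) (‖w‖ + |c|) fun y hy ↦ by
        simpa using hbound (-y) (by simpa using hy)
    have hi : Integrable (fun y ↦ (inner ℝ w y : ℝ) ^ 2) μ :=
      integrable_of_continuous_of_bound hμ (by fun_prop) (‖w‖ ^ 2) fun y hy ↦ abs_inner_sq_le w hy
    have hneg : ∫ y, ‖w + c • (-y)‖ ∂μ = ∫ y, ‖w + c • y‖ ∂μ :=
      integral_comp_linearIsometryEquiv hinv (LinearIsometryEquiv.neg ℝ) fun y ↦ ‖w + c • y‖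
    have hmono := integral_mono_ae (((integrable_const 2).sub (hi.const_mul _)).const_mul _)
      (hf.add hg) (hμ.mono fun y hy ↦ le_norm_add_add_norm_sub w hy hc)
    simp only [Pi.sub_apply, Pi.add_apply] at hmono
    rw [integral_const_mul, integral_sub (integrable_const 2) (hi.const_mul _),
      integral_const_mul, integral_add hf hg, hneg] at hmono
    simp only [integral_const, probReal_univ, one_smul] at hmono
    have hsq := integral_inner_sq_le (by simpa using hn) hμ hinv w
    have hfin := sqrt_add_four_le (sq_nonneg ‖w‖)
    have hstep := hfin.trans (le_trans (mul_le_mul_of_nonneg_left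
      (sub_le_sub_left (mul_le_mul_of_nonneg_left hsq (by positivity)) 2)
      (Real.sqrt_nonneg _)) hmono)
    linarith
end

section
/- Let T be a positive integer and F a nonempty finite subset of [−1,1]^T; write f = (f[1],…,f[T]). For y_1,…,y_t ∈ {−1,1} define Rel(y_1,…,y_t) = 2^{−(T−t)} Σ_{ε∈{−1,1}^{T−t}} max_{f∈F} [ Σ_{s=t+1}^T ε_{s−t} f[s] − Σ_{s=1}^t |f[s] − y_s| ]. For 1 ≤ t ≤ T define the forecaster q_t = (1/2)·2^{−(T−t)} Σ_{ε∈{−1,1}^{T−t}} [ max_{f∈F}( Σ_{s=t+1}^T ε_{s−t} f[s] − Σ_{s=1}^{t−1} |f[s]−y_s| + f[t] ) − max_{f∈F}( Σ_{s=t+1}^T ε_{s−t} f[s] − Σ_{s=1}^{t−1} |f[s]−y_s| − f[t] ) ]. Then q_t ∈ [−1,1]; for every y_t ∈ {−1,1}, |q_t − y_t| + Rel(y_1,…,y_t) ≤ Rel(y_1,…,y_{t−1}); and consequently, for every sequence y ∈ {−1,1}^T, Σ_{t=1}^T |q_t − y_t| − min_{f∈F} Σ_{t=1}^T |f[t] −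 y_t| ≤ 2^{−T} Σ_{ε∈{−1,1}^T} max_{f∈F} Σ_{t=1}^T ε_t f[t]. -/
/-- The conditional classical Rademacher relaxation for static experts with absolute
loss: `Rel(y_1,…,y_t) = E_ε max_{f∈F} [ Σ_{s>t} ε_s f[s] − Σ_{s≤t} |f[s] − y_s| ]`. -/
noncomputable def relAbs (T : ℕ) (F : Finset (Fin T → ℝ)) (hF : F.Nonempty)
    (y : Fin T → ℝ) (t : ℕ) (ht : t ≤ T) : ℝ :=
  (2 : ℝ)⁻¹ ^ (T - t) *
    ∑ ε : Fin (T - t) → Bool,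
      F.sup' hF (fun f =>
        (∑ j : Fin (T - t), (if ε j then (1 : ℝ) else -1) *
            f ⟨t + j.val, by have := j.isLt; omega⟩)
          - ∑ s : Fin T, if s.val < t then |f s - y s| else 0)

/-- Splitting a sum over sign vectors according to the first sign. -/
theorem sum_signs_sup'_succ {α : Type*} {m n : ℕ} (h : m = n + 1) (F : Finset α)
    (hF : F.Nonempty) (a : α → Fin m → ℝ) (c : α → ℝ) :
    ∑ ε : Fin m → Bool,
        F.sup' hF (fun f => (∑ j, (if ε j then (1 : ℝ) else -1) * a f j) - c f) =
      ∑ ε : Fin n → Bool,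
        (F.sup' hF (fun f => (∑ j : Fin n, (if ε j then (1 : ℝ) else -1) *
            a f (Fin.cast h.symm j.succ)) - c f + a f (Fin.cast h.symm 0)) +
          F.sup' hF (fun f => (∑ j : Fin n, (if ε j then (1 : ℝ) else -1) *
            a f (Fin.cast h.symm j.succ)) - c f - a f (Fin.cast h.symm 0))) := by
  subst h
  rw [← (Fin.consEquiv (fun _ => Bool)).sum_comp, Fintype.sum_prod_type, Fintype.sum_bool,
    ← Finset.sum_add_distrib]
  refine Finset.sum_congr rfl fun ε _ => ?_
  congr 1 <;> refine Finset.sup'_congr hF rfl fun f _ => ?_ <;>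
    simp [Fin.consEquiv, Fin.sum_univ_succ] <;> ring

theorem sup'_add_const {α : Type*} (F : Finset α) (hF : F.Nonempty) (g : α → ℝ) (c : ℝ) :
    F.sup' hF (fun f => g f + c) = F.sup' hF g + c :=
  (Finset.apply_sup'_eq_sup'_comp hF (fun x => x + c) fun x y => (max_add_add_right x y c).symm).symm

theorem sup'_add_le_sup'_sub_add_two {α : Type*} (F : Finset α) (hF : F.Nonempty)
    (g b : α → ℝ) (hb : ∀ f ∈ F, b f ≤ 1) :
    F.sup' hF (fun f => g f + b f) ≤ F.sup' hF (fun f => g f - b f) + 2 := by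
  refine Finset.sup'_le hF _ fun f hf => ?_
  have := Finset.le_sup' (fun f => g f - b f) hf
  have := hb f hf
  linarith

theorem inv_two_pow_mul_sum_const (n : ℕ) (c : ℝ) :
    (2 : ℝ)⁻¹ ^ n * ∑ _ε : Fin n → Bool, c = c := by
  simp

theorem sum_ite_lt_succ {T : ℕ} (a : Fin T → ℝ) {t : ℕ} (ht : t < T) :
    (∑ s : Fin T, if s.val < t + 1 then a s else 0) =
      (∑ s : Fin T, if s.val < t then a s else 0) + a ⟨t, ht⟩ := by
  have h (s : Fin T) : (if s.val < t + 1 then a s else 0) =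
      (if s.val < t then a s else 0) + if s = ⟨t, ht⟩ then a s else 0 := by
    rcases lt_trichotomy s.val t with h | h | h
    · simp [h, Fin.ext_iff, h.ne, h.trans (Nat.lt_succ_self t)]
    · simp [h, Fin.ext_iff]
    · simp [Fin.ext_iff, h.ne', h.not_gt, Nat.not_lt.mpr (Nat.succ_le_of_lt h)]
  rw [Finset.sum_congr rfl fun s _ => h s, Finset.sum_add_distrib, Finset.sum_ite_eq']
  simp

/-- The objective `Σ_{s>t} ε_s f[s] − Σ_{s<t} |f[s] − y_s|`, which leaves out round `t`. -/
noncomputable def signedObjective {T : ℕ} (y : Fin T → ℝ) (t : ℕ)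
    (ε : Fin (T - (t + 1)) → Bool) (f : Fin T → ℝ) : ℝ :=
  (∑ j : Fin (T - (t + 1)), (if ε j then (1 : ℝ) else -1) *
      f ⟨t + 1 + j.val, by have := j.isLt; omega⟩)
    - (∑ s : Fin T, if s.val < t then |f s - y s| else 0)

section

variable {T : ℕ} {F : Finset (Fin T → ℝ)} (hF : F.Nonempty) (y : Fin T → ℝ) {t : ℕ} (ht : t < T)

theorem relAbs_eq_half_sum :
    relAbs T F hF y t ht.le = (1 / 2 : ℝ) * ((2 : ℝ)⁻¹ ^ (T - (t + 1)) *
      ∑ ε : Fin (T - (t + 1)) → Bool,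
        (F.sup' hF (fun f => signedObjective y t ε f + f ⟨t, ht⟩) +
          F.sup' hF (fun f => signedObjective y t ε f - f ⟨t, ht⟩))) := by
  have h : T - t = T - (t + 1) + 1 := by omega
  have hp : (2 : ℝ)⁻¹ ^ (T - t) = 1 / 2 * (2 : ℝ)⁻¹ ^ (T - (t + 1)) := by
    rw [h, pow_succ]; ring
  have hidx (j : Fin (T - (t + 1))) : t + (j.val + 1) = t + 1 + j.val := by omega
  rw [relAbs, sum_signs_sup'_succ h, hp, mul_assoc]
  simp [signedObjective, hidx]

theorem relAbs_succ {b : ℝ} (hb : y ⟨t, ht⟩ = b) {u : (Fin T → ℝ) → ℝ}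
    (hu : ∀ f ∈ F, -|f ⟨t, ht⟩ - b| = u f - 1) :
    relAbs T F hF y (t + 1) ht = (2 : ℝ)⁻¹ ^ (T - (t + 1)) *
      (∑ ε : Fin (T - (t + 1)) → Bool,
        F.sup' hF (fun f => signedObjective y t ε f + u f)) - 1 := by
  have h (ε : Fin (T - (t + 1)) → Bool) :
      F.sup' hF (fun f => (∑ j : Fin (T - (t + 1)), (if ε j then (1 : ℝ) else -1) *
          f ⟨t + 1 + j.val, by have := j.isLt; omega⟩)
          - ∑ s : Fin T, if s.val < t + 1 then |f s - y s| else 0) =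
        F.sup' hF (fun f => signedObjective y t ε f + u f) + -1 := by
    rw [← sup'_add_const]
    refine Finset.sup'_congr hF rfl fun f hf => ?_
    rw [sum_ite_lt_succ _ ht, signedObjective, hb]
    linarith [hu f hf]
  rw [relAbs, Finset.sum_congr rfl fun ε _ => h ε, Finset.sum_add_distrib, mul_add,
    inv_two_pow_mul_sum_const, sub_eq_add_neg]

theorem neg_inf'_le_relAbs_self :
    -F.inf' hF (fun f => ∑ t : Fin T, |f t - y t|) ≤ relAbs T F hF y T le_rfl := by
  obtain ⟨f, hf, hinf⟩ := F.exists_mem_eq_inf' hF (fun f => ∑ t : Fin T, |f t - y t|)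
  rw [hinf, relAbs, ← inv_two_pow_mul_sum_const (T - T) (-∑ t : Fin T, |f t - y t|)]
  gcongr with ε
  refine le_trans (le_of_eq ?_) (Finset.le_sup' _ hf)
  have : IsEmpty (Fin (T - T)) := by rw [Nat.sub_self]; infer_instance
  simp

theorem relAbs_zero :
    relAbs T F hF y 0 T.zero_le = (2 : ℝ)⁻¹ ^ T * ∑ ε : Fin T → Bool,
      F.sup' hF (fun f => ∑ t : Fin T, (if ε t then (1 : ℝ) else -1) * f t) := by
  simp [relAbs]

theorem sum_add_relAbs_le {q : ℕ → ℝ}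
    (hadm : ∀ t, ∀ (ht : t < T), |q t - y ⟨t, ht⟩| + relAbs T F hF y (t + 1) ht
      ≤ relAbs T F hF y t ht.le) (k : ℕ) (hk : k ≤ T) :
    (∑ t : Fin k, |q t.val - y (Fin.castLE hk t)|) + relAbs T F hF y k hk
      ≤ relAbs T F hF y 0 T.zero_le := by
  induction k with
  | zero => simp
  | succ k ih =>
    have h1 := ih (Nat.le_of_succ_le hk)
    have h2 := hadm k hk
    rw [Fin.sum_univ_castSucc]
    have h3 : Fin.castLE hk (Fin.last k) = ⟨k, hk⟩ := rfl
    simp only [Fin.castLE_castSucc, Fin.val_castSucc, Fin.val_last, h3]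
    linarith

end

/-- the minimax optimal forecaster for static experts with absolute loss
(Section 8): the prediction `q_t` lies in `[−1,1]`, the relaxation `relAbs` is
admissible with respect to it, and the regret is bounded by the classical Rademacher
complexity of `F`. -/
theorem static_experts_absolute_loss
    (T : ℕ) (hT : 0 < T)
    (F : Finset (Fin T → ℝ)) (hF : F.Nonempty)
    (hFbd : ∀ f ∈ F, ∀ s : Fin T, |f s| ≤ 1)
    (y : Fin T → ℝ) (hy : ∀ t, y t = 1 ∨ y t = -1)
    (q : ℕ → ℝ)
    (hq : ∀ t, ∀ (ht : t < T), q t =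
      (1 / 2 : ℝ) * ((2 : ℝ)⁻¹ ^ (T - (t + 1)) *
        ∑ ε : Fin (T - (t + 1)) → Bool,
          (F.sup' hF (fun f =>
              (∑ j : Fin (T - (t + 1)), (if ε j then (1 : ℝ) else -1) *
                  f ⟨t + 1 + j.val, by have := j.isLt; omega⟩)
                - (∑ s : Fin T, if s.val < t then |f s - y s| else 0)
                + f ⟨t, ht⟩)
            - F.sup' hF (fun f =>
              (∑ j : Fin (T - (t + 1)), (if ε j then (1 : ℝ) else -1) *
                  f ⟨t + 1 + j.val, by have := j.isLt; omega⟩)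
                - (∑ s : Fin T, if s.val < t then |f s - y s| else 0)
                - f ⟨t, ht⟩)))) :
    (∀ t, ∀ (_ : t < T), -1 ≤ q t ∧ q t ≤ 1) ∧
    (∀ t, ∀ (ht : t < T),
      |q t - y ⟨t, ht⟩| + relAbs T F hF y (t + 1) ht
        ≤ relAbs T F hF y t (le_of_lt ht)) ∧
    (∑ t : Fin T, |q t.val - y t|) - F.inf' hF (fun f => ∑ t : Fin T, |f t - y t|)
      ≤ (2 : ℝ)⁻¹ ^ T *
          ∑ ε : Fin T → Bool,
            F.sup' hF (fun f => ∑ t : Fin T, (if ε t then (1 : ℝ) else -1) * f t) := by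
  have hq' : ∀ t, ∀ (ht : t < T), q t = (1 / 2 : ℝ) * ((2 : ℝ)⁻¹ ^ (T - (t + 1)) *
      ∑ ε : Fin (T - (t + 1)) → Bool,
        (F.sup' hF (fun f => signedObjective y t ε f + f ⟨t, ht⟩) -
          F.sup' hF (fun f => signedObjective y t ε f - f ⟨t, ht⟩))) := hq
  have hbd : ∀ t, ∀ (_ : t < T), -1 ≤ q t ∧ q t ≤ 1 := by
    intro t ht
    have hle (ε : Fin (T - (t + 1)) → Bool) :=
      sup'_add_le_sup'_sub_add_two F hF (signedObjective y t ε) (fun f => f ⟨t, ht⟩)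
        fun f hf => (abs_le.mp (hFbd f hf _)).2
    have hge (ε : Fin (T - (t + 1)) → Bool) :=
      sup'_add_le_sup'_sub_add_two F hF (signedObjective y t ε) (fun f => -f ⟨t, ht⟩)
        fun f hf => neg_le.mp (abs_le.mp (hFbd f hf _)).1
    simp only [sub_neg_eq_add, ← sub_eq_add_neg] at hge
    have hdiff (ε : Fin (T - (t + 1)) → Bool) :
        -2 ≤ F.sup' hF (fun f => signedObjective y t ε f + f ⟨t, ht⟩) -
          F.sup' hF (fun f => signedObjective y t ε f - f ⟨t, ht⟩) := by
      linarith [hge ε]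
    have hpow : (0 : ℝ) ≤ (2 : ℝ)⁻¹ ^ (T - (t + 1)) := by positivity
    have hupper := mul_le_mul_of_nonneg_left (Finset.sum_le_sum fun ε
      (_ : ε ∈ Finset.univ) => sub_le_iff_le_add'.mpr (hle ε)) hpow
    have hlower := mul_le_mul_of_nonneg_left (Finset.sum_le_sum fun ε
      (_ : ε ∈ Finset.univ) => hdiff ε) hpow
    rw [inv_two_pow_mul_sum_const] at hupper hlower
    rw [hq' t ht]
    constructor <;> linarith
  have hadm : ∀ t, ∀ (ht : t < T), |q t - y ⟨t, ht⟩| + relAbs T F hF y (t + 1) ht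
      ≤ relAbs T F hF y t (le_of_lt ht) := by
    intro t ht
    have hqt := hq' t ht
    have hrel := relAbs_eq_half_sum hF y ht
    rw [Finset.sum_sub_distrib, mul_sub] at hqt
    rw [Finset.sum_add_distrib, mul_add] at hrel
    obtain ⟨hl, hu⟩ := hbd t ht
    rcases hy ⟨t, ht⟩ with hyt | hyt
    · rw [relAbs_succ hF y ht hyt (u := fun f => f ⟨t, ht⟩), hyt, abs_of_nonpos (by linarith)]
      · linarith
      · intro f hf
        rw [abs_of_nonpos (by linarith [(abs_le.mp (hFbd f hf ⟨t, ht⟩)).2])]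
        ring
    · rw [relAbs_succ hF y ht hyt (u := fun f => -f ⟨t, ht⟩), hyt, abs_of_nonneg (by linarith)]
      · simp only [← sub_eq_add_neg]
        linarith
      · intro f hf
        rw [abs_of_nonneg (by linarith [(abs_le.mp (hFbd f hf ⟨t, ht⟩)).1])]
        ring
  refine ⟨hbd, hadm, ?_⟩
  have hsum := sum_add_relAbs_le hF y hadm T le_rfl
  rw [relAbs_zero] at hsum
  simp only [Fin.castLE_rfl, id_eq] at hsum
  linarith [neg_inf'_le_relAbs_self hF y]
end

section
/- Let T be a positive integer, L > 0, and F a nonempty finite subset of ℝ^T; write f = (f[1],…,f[T]). Let r_1,…,r_T ∈ [−L, L] be arbitrary. For each 1 ≤ t ≤ T define the prediction (depending only on r_1,…,r_{t−1}): ŷ_t = 2^{−(T−t)} Σ_{ε∈{−1,1}^{T−t}} [ max_{f∈F}( Σ_{i=t+1}^T ε_{i−t} f[i] − (1/(2L)) Σ_{i=1}^{t−1} r_i f[i] + f[t]/2 ) − max_{f∈F}( Σ_{i=t+1}^T ε_{i−t} f[i] − (1/(2L)) Σ_{i=1}^{t−1} r_i f[i] − f[t]/2 ) ]. Then Σ_{t=1}^T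 r_t ŷ_t − min_{f∈F} Σ_{t=1}^T r_t f[t] ≤ 2L · 2^{−T} Σ_{ε∈{−1,1}^T} max_{f∈F} Σ_{t=1}^T ε_t f[t]. -/
/-- Averaging over the last `n` of `m + n = T` signs is averaging over all `T` signs. -/
lemma sum_signs_tail {m n T : ℕ} (h : m + n = T) (φ : (Fin n → Bool) → ℝ) :
    ∑ ε : Fin T → Bool, φ (fun j => ε ⟨m + j.val, by have := j.isLt; omega⟩) =
      2 ^ m * ∑ ε : Fin n → Bool, φ ε := by
  subst h
  rw [← (Fin.appendEquiv m n (α := Bool)).sum_comp, Fintype.sum_prod_type]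
  have key (x : Fin m → Bool) (y : Fin n → Bool) :
      (fun j : Fin n => Fin.appendEquiv m n (x, y) ⟨m + j.val, by have := j.isLt; omega⟩) = y :=
    funext fun j => Fin.append_right x y j
  simp only [key]
  simp

lemma sum_fin_tail {m n T : ℕ} (h : m + n = T) (g : Fin T → ℝ) :
    ∑ j : Fin n, g ⟨m + j.val, by have := j.isLt; omega⟩ =
      ∑ i : Fin T, if m ≤ i.val then g i else 0 := by
  subst h
  rw [Fin.sum_univ_add]
  have h₀ : ∀ i : Fin m, ¬ m ≤ i.val := fun i => by have := i.isLt; omega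
  simp [h₀, Fin.natAdd]

/-- Splitting off the summand at `t` from a tail sum. -/
lemma sum_ite_le_eq_add {T : ℕ} (t : Fin T) (g : Fin T → ℝ) :
    (∑ i : Fin T, if t.val ≤ i.val then g i else 0) =
      (∑ i : Fin T, if t.val + 1 ≤ i.val then g i else 0) + g t := by
  rw [← Fintype.sum_ite_eq t g, ← Finset.sum_add_distrib]
  refine Finset.sum_congr rfl fun i _ => ?_
  rcases lt_trichotomy t i with h | h | h
  · have : t.val < i.val := h
    simp [this.le, Nat.succ_le_of_lt this, h.ne]
  · simp [h]
  · have : i.val < t.val := h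
    simp [h.ne', this.not_ge, show ¬ t.val + 1 ≤ i.val by omega]

/-- Splitting off the summand at `t` from a head sum. -/
lemma sum_ite_lt_succ_eq_add {T : ℕ} (t : Fin T) (g : Fin T → ℝ) :
    (∑ i : Fin T, if i.val < t.val + 1 then g i else 0) =
      (∑ i : Fin T, if i.val < t.val then g i else 0) + g t := by
  rw [← Fintype.sum_ite_eq t g, ← Finset.sum_add_distrib]
  refine Finset.sum_congr rfl fun i _ => ?_
  rcases lt_trichotomy t i with h | h | h
  · have : t.val < i.val := h
    simp [h.ne, show ¬ i.val < t.val + 1 by omega, this.not_gt]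
  · simp [h]
  · have : i.val < t.val := h
    simp [h.ne', this, show i.val < t.val + 1 by omega]

lemma sum_signs_flip {ι : Type*} [Fintype ι] [DecidableEq ι] (t : ι) (φ : (ι → Bool) → ℝ) :
    ∑ ε : ι → Bool, φ (Function.update ε t (!ε t)) = ∑ ε : ι → Bool, φ ε := by
  have hinv : Function.Involutive fun ε : ι → Bool => Function.update ε t (!ε t) := by
    intro ε
    simp
  exact Equiv.sum_comp hinv.toPerm φ

/-- A maximum of affine functions is convex. -/
lemma convexOn_sup'_affine {α : Type*} (F : Finset α) (hF : F.Nonempty) (A B : α → ℝ) :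
    ConvexOn ℝ Set.univ fun c : ℝ => F.sup' hF fun f => A f + c * B f := by
  refine ⟨convex_univ, fun x _ y _ a b ha hb hab => Finset.sup'_le _ _ fun f hf => ?_⟩
  have hx := Finset.le_sup' (fun f => A f + x * B f) hf
  have hy := Finset.le_sup' (fun f => A f + y * B f) hf
  simp only [smul_eq_mul]
  calc A f + (a * x + b * y) * B f = a * (A f + x * B f) + b * (A f + y * B f) := by
        linear_combination (-A f) * hab
    _ ≤ _ := by gcongr

/-- One-step admissibility inequality for a convex function. -/
lemma ConvexOn.half_difference_add_le {G : ℝ → ℝ} (hG : ConvexOn ℝ Set.univ G) {u : ℝ}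
    (hu : |u| ≤ 1 / 2) :
    u * (G (1 / 2) - G (-(1 / 2))) + G (-u) ≤ (G 1 + G (-1)) / 2 := by
  obtain ⟨h₁, h₂⟩ := abs_le.mp hu
  have e := hG.2 (Set.mem_univ (1 / 2)) (Set.mem_univ (-(1 / 2)))
    (show 0 ≤ 1 / 2 - u by linarith) (show 0 ≤ 1 / 2 + u by linarith) (by ring)
  have p := hG.2 (Set.mem_univ 1) (Set.mem_univ (-1))
    (show (0 : ℝ) ≤ 3 / 4 by norm_num) (show (0 : ℝ) ≤ 1 / 4 by norm_num) (by norm_num)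
  have q := hG.2 (Set.mem_univ 1) (Set.mem_univ (-1))
    (show (0 : ℝ) ≤ 1 / 4 by norm_num) (show (0 : ℝ) ≤ 3 / 4 by norm_num) (by norm_num)
  simp only [smul_eq_mul] at e p q
  rw [show (1 / 2 - u) * (1 / 2) + (1 / 2 + u) * -(1 / 2) = -u by ring] at e
  rw [show (3 / 4 : ℝ) * 1 + 1 / 4 * -1 = 1 / 2 by norm_num] at p
  rw [show (1 / 4 : ℝ) * 1 + 3 / 4 * -1 = -(1 / 2) by norm_num] at q
  linarith

/-- The part of the relaxation built from the signs at positions `≥ k` and the multipliers at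
positions `< l`. -/
noncomputable def signedPotential {T : ℕ} (L : ℝ) (r : Fin T → ℝ) (k l : ℕ) (ε : Fin T → Bool)
    (f : Fin T → ℝ) : ℝ :=
  (∑ i : Fin T, if k ≤ i.val then (if ε i then (1 : ℝ) else -1) * f i else 0)
    - (1 / (2 * L)) * (∑ s : Fin T, if s.val < l then r s * f s else 0)

/-- The linearized Rademacher relaxation after `k` rounds, divided by `2 * L`. -/
noncomputable def linearizedRelaxation {T : ℕ} (L : ℝ) (F : Finset (Fin T → ℝ)) (hF : F.Nonempty)
    (r : Fin T → ℝ) (k : ℕ) : ℝ :=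
  (2 : ℝ)⁻¹ ^ T * ∑ ε : Fin T → Bool, F.sup' hF (signedPotential L r k k ε)

/-- The relaxation is admissible for the half-difference prediction. -/
lemma linearizedRelaxation_step {T : ℕ} {L : ℝ} (hL : 0 < L) (F : Finset (Fin T → ℝ))
    (hF : F.Nonempty) (r : Fin T → ℝ) (t : Fin T) (hr : |r t| ≤ L) :
    r t / (2 * L) * ((2 : ℝ)⁻¹ ^ T * ∑ ε : Fin T → Bool,
        (F.sup' hF (fun f => signedPotential L r (t + 1) t ε f + f t / 2)
          - F.sup' hF (fun f => signedPotential L r (t + 1) t ε f - f t / 2)))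
      + linearizedRelaxation L F hF r (t + 1) ≤ linearizedRelaxation L F hF r t := by
  let G (ε : Fin T → Bool) (c : ℝ) : ℝ :=
    F.sup' hF fun f => signedPotential L r (t + 1) t ε f + c * f t
  have hu : |r t / (2 * L)| ≤ 1 / 2 := by
    rw [abs_div, abs_of_pos (by positivity : 0 < 2 * L), div_le_iff₀ (by positivity)]
    linarith
  have hhalf (ε) : F.sup' hF (fun f => signedPotential L r (t + 1) t ε f + f t / 2)
      = G ε (1 / 2) := by
    simp only [G]
    congr 1; ext f; ring
  have hneg (ε) : F.sup' hF (fun f => signedPotential L r (t + 1) t ε f - f t / 2)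
      = G ε (-(1 / 2)) := by
    simp only [G]
    congr 1; ext f; ring
  have hnext (ε) : F.sup' hF (signedPotential L r (t + 1) (t + 1) ε)
      = G ε (-(r t / (2 * L))) := by
    simp only [G]
    congr 1; ext f
    simp only [signedPotential, sum_ite_lt_succ_eq_add]
    ring
  have hcur (ε) : F.sup' hF (signedPotential L r t t ε) = G ε (if ε t then 1 else -1) := by
    simp only [G]
    congr 1; ext f
    simp only [signedPotential, sum_ite_le_eq_add]
    ring
  have hflip (ε : Fin T → Bool) (c : ℝ) : G (Function.update ε t (!ε t)) c = G ε c := by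
    simp only [G]
    congr 1; ext f
    simp only [signedPotential]
    have hsum : ∀ i : Fin T, (if t.val + 1 ≤ i.val then
        (if Function.update ε t (!ε t) i then (1 : ℝ) else -1) * f i else 0)
        = if t.val + 1 ≤ i.val then (if ε i then (1 : ℝ) else -1) * f i else 0 := by
      intro i
      by_cases hi : i = t
      · simp [hi]
      · rw [Function.update_of_ne hi]
    simp only [hsum]
  have hsymm : ∑ ε : Fin T → Bool, G ε (if ε t then 1 else -1)
      = ∑ ε : Fin T → Bool, (G ε 1 + G ε (-1)) / 2 := by
    have h := sum_signs_flip t fun ε => G ε (if ε t then 1 else -1)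
    have hadd : ∑ ε : Fin T → Bool, (G ε 1 + G ε (-1))
        = ∑ ε : Fin T → Bool, G ε (if ε t then 1 else -1)
          + ∑ ε : Fin T → Bool, G (Function.update ε t (!ε t))
              (if Function.update ε t (!ε t) t then 1 else -1) := by
      rw [← Finset.sum_add_distrib]
      refine Finset.sum_congr rfl fun ε _ => ?_
      rw [hflip]
      cases h : ε t <;> simp [add_comm]
    rw [← Finset.sum_div, hadd, h]
    ring
  simp only [linearizedRelaxation, hhalf, hneg, hnext, hcur, hsymm]
  rw [mul_left_comm, ← mul_add, Finset.mul_sum, ← Finset.sum_add_distrib]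
  gcongr with ε
  exact (convexOn_sup'_affine F hF _ _).half_difference_add_le hu


/-- the linearized forecaster for transductive online learning / static
experts (Lemma 16): against any multipliers `r_t ∈ [−L, L]`, the prediction strategy
based on the linearized Rademacher relaxation has linearized regret at most twice `L`
times the classical Rademacher complexity of `F`. -/
theorem linearized_transductive_regret
    (T : ℕ) (hT : 0 < T) (L : ℝ) (hL : 0 < L)
    (F : Finset (Fin T → ℝ)) (hF : F.Nonempty)
    (r : Fin T → ℝ) (hr : ∀ t, |r t| ≤ L)
    (yhat : ℕ → ℝ)
    (hyhat : ∀ t, ∀ (ht : t < T), yhat t =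
      (2 : ℝ)⁻¹ ^ (T - (t + 1)) *
        ∑ ε : Fin (T - (t + 1)) → Bool,
          (F.sup' hF (fun f =>
              (∑ j : Fin (T - (t + 1)), (if ε j then (1 : ℝ) else -1) *
                  f ⟨t + 1 + j.val, by have := j.isLt; omega⟩)
                - (1 / (2 * L)) * (∑ s : Fin T, if s.val < t then r s * f s else 0)
                + f ⟨t, ht⟩ / 2)
            - F.sup' hF (fun f =>
              (∑ j : Fin (T - (t + 1)), (if ε j then (1 : ℝ) else -1) *
                  f ⟨t + 1 + j.val, by have := j.isLt; omega⟩)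
                - (1 / (2 * L)) * (∑ s : Fin T, if s.val < t then r s * f s else 0)
                - f ⟨t, ht⟩ / 2))) :
    (∑ t : Fin T, r t * yhat t.val) - F.inf' hF (fun f => ∑ t : Fin T, r t * f t)
      ≤ 2 * L * ((2 : ℝ)⁻¹ ^ T *
          ∑ ε : Fin T → Bool,
            F.sup' hF (fun f => ∑ t : Fin T, (if ε t then (1 : ℝ) else -1) * f t)) := by
  have hpred (t : Fin T) : yhat t = (2 : ℝ)⁻¹ ^ T * ∑ ε : Fin T → Bool,
      (F.sup' hF (fun f => signedPotential L r (t + 1) t ε f + f t / 2)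
        - F.sup' hF (fun f => signedPotential L r (t + 1) t ε f - f t / 2)) := by
    have hsum : t.val + 1 + (T - (t.val + 1)) = T := by have := t.isLt; omega
    have hpot (ε : Fin T → Bool) (f : Fin T → ℝ) := sum_fin_tail hsum
      fun i => (if ε i then (1 : ℝ) else -1) * f i
    simp only [signedPotential, ← hpot]
    rw [hyhat t t.isLt]
    have hpow : (2 : ℝ)⁻¹ ^ (T - (t.val + 1)) = (2 : ℝ)⁻¹ ^ T * 2 ^ (t.val + 1) := by
      rw [← pow_sub_mul_pow (2 : ℝ)⁻¹ t.isLt, mul_assoc, Nat.succ_eq_add_one, ← mul_pow]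
      norm_num
    rw [hpow, mul_assoc, ← sum_signs_tail hsum]
  have hstep (t : Fin T) : r t * yhat t ≤ 2 * L *
      (linearizedRelaxation L F hF r t - linearizedRelaxation L F hF r (t + 1)) := by
    have h := linearizedRelaxation_step hL F hF r t (hr t)
    rw [← hpred] at h
    calc r t * yhat t = 2 * L * (r t / (2 * L) * yhat t) := by field_simp
      _ ≤ _ := by gcongr; linarith
  have hregret : ∑ t : Fin T, r t * yhat t ≤ 2 * L *
      (linearizedRelaxation L F hF r 0 - linearizedRelaxation L F hF r T) := by
    refine (Finset.sum_le_sum fun t _ => hstep t).trans_eq ?_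
    rw [← Finset.mul_sum, Fin.sum_univ_eq_sum_range (fun k =>
      linearizedRelaxation L F hF r k - linearizedRelaxation L F hF r (k + 1)),
      Finset.sum_range_sub']
  have hlast : -F.inf' hF (fun f => ∑ t : Fin T, r t * f t)
      ≤ 2 * L * linearizedRelaxation L F hF r T := by
    obtain ⟨f, hf, hmin⟩ := F.exists_mem_eq_inf' hF (fun f => ∑ t : Fin T, r t * f t)
    have hpot (ε : Fin T → Bool) : signedPotential L r T T ε f
        = -(1 / (2 * L)) * ∑ t : Fin T, r t * f t := by
      simp [signedPotential, fun i : Fin T => i.isLt.not_ge]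
    have hle : -(1 / (2 * L)) * ∑ t : Fin T, r t * f t ≤ linearizedRelaxation L F hF r T := by
      calc _ = (2 : ℝ)⁻¹ ^ T * ∑ ε : Fin T → Bool, signedPotential L r T T ε f := by
            simp [hpot]
        _ ≤ _ := by
            unfold linearizedRelaxation
            gcongr with ε
            exact Finset.le_sup' _ hf
    rw [hmin]
    calc _ = 2 * L * (-(1 / (2 * L)) * ∑ t : Fin T, r t * f t) := by field_simp
      _ ≤ _ := by gcongr
  have hfirst : linearizedRelaxation L F hF r 0 = (2 : ℝ)⁻¹ ^ T * ∑ ε : Fin T → Bool,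
      F.sup' hF (fun f => ∑ t : Fin T, (if ε t then (1 : ℝ) else -1) * f t) := by
    have hpot (ε : Fin T → Bool) : signedPotential L r 0 0 ε
        = fun f => ∑ t : Fin T, (if ε t then (1 : ℝ) else -1) * f t := by
      ext f
      simp [signedPotential]
    simp only [linearizedRelaxation, hpot]
  rw [← hfirst]
  linarith
end

section
/- Let T be a positive integer, L > 0, Y a nonempty set, and ℓ : ℝ × Y → ℝ such that for every y ∈ Y the map ŷ ↦ ℓ(ŷ, y) is convex and L-Lipschitz. Let F be a nonempty finite subset of ℝ^T (write f = (f[1],…,f[T])) and let y_1,…,y_T ∈ Y. For 1 ≤ t ≤ T and ε ∈ {−1,1}^{T−t} define the randomized prediction ŷ_t(ε) = max_{f∈F}( Σ_{i=t+1}^T ε_{i−t} f[i] − (1/(2L)) Σ_{i=1}^{t−1} ℓ(f[i], y_i) + f[t]/2 ) − max_{f∈F}( Σ_{i=t+1}^T ε_{i−t} f[i] − (1/(2L)) Σ_{i=1}^{t−1} ℓ(f[i], y_i) − f[t]/2 ). Then Σ_{t=1}^T 2^{−(T−t)} Σ_{ε∈{−1,1}^{T−t}} ℓ( ŷ_t(ε),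 y_t ) − min_{f∈F} Σ_{t=1}^T ℓ( f[t], y_t ) ≤ 2L · 2^{−T} Σ_{ε∈{−1,1}^T} max_{f∈F} Σ_{t=1}^T ε_t f[t]. -/
/-- Averaging a function of the coordinates selected by an injection is the same as averaging it
over all sign patterns. -/
lemma average_comp_injective {m n : ℕ} (e : Fin m → Fin n) (he : Function.Injective e)
    (G : (Fin m → Bool) → ℝ) :
    (2 : ℝ)⁻¹ ^ m * ∑ ε, G ε = (2 : ℝ)⁻¹ ^ n * ∑ ε : Fin n → Bool, G (ε ∘ e) := by
  classical
  have hmn : m ≤ n := by simpa using Fintype.card_le_of_injective e he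
  let φ := Equiv.piEquivPiSubtypeProd (fun i => i ∈ Set.range e) (fun _ => Bool)
  let ψ : (Fin m → Bool) ≃ (Set.range e → Bool) :=
    (Equiv.ofInjective e he).arrowCongr (Equiv.refl Bool)
  have hcard : Fintype.card {i // i ∉ Set.range e} = n - m := by
    rw [Fintype.card_subtype_compl, Fintype.card_fin]
    congr 1
    rw [← Fintype.card_congr (Equiv.ofInjective e he), Fintype.card_fin]
  have hsum : ∑ ε : Fin n → Bool, G (ε ∘ e) = 2 ^ (n - m) * ∑ ε, G ε := by
    calc ∑ ε : Fin n → Bool, G (ε ∘ e)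
        = ∑ p : (Set.range e → Bool) × ({i // i ∉ Set.range e} → Bool), G (ψ.symm p.1) :=
          Fintype.sum_equiv φ _ _ fun ε => congrArg G (by ext i; rfl)
      _ = 2 ^ (n - m) * ∑ q : Set.range e → Bool, G (ψ.symm q) := by
          rw [Fintype.sum_prod_type, Finset.mul_sum]
          refine Finset.sum_congr rfl fun q _ => ?_
          simp only [Finset.sum_const, nsmul_eq_mul, Finset.card_univ, Fintype.card_fun,
            Fintype.card_bool, hcard, Nat.cast_pow, Nat.cast_ofNat]
      _ = 2 ^ (n - m) * ∑ ε, G ε := by rw [Equiv.sum_comp ψ.symm G]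
  rw [hsum, ← mul_assoc]
  congr 1
  obtain ⟨k, rfl⟩ := Nat.exists_eq_add_of_le hmn
  rw [Nat.add_sub_cancel_left, pow_add, mul_assoc, ← mul_pow]
  norm_num

/-- Halving a perturbation does not increase the sum of the two perturbed maxima. -/
lemma sup'_add_half_add_sup'_sub_half_le {α : Type*} (F : Finset α) (hF : F.Nonempty)
    (A v : α → ℝ) :
    F.sup' hF (fun f => A f + v f / 2) + F.sup' hF (fun f => A f - v f / 2)
      ≤ F.sup' hF (fun f => A f + v f) + F.sup' hF (fun f => A f - v f) := by
  obtain ⟨f, hf, hfa⟩ := F.exists_mem_eq_sup' hF (fun f => A f + v f / 2)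
  obtain ⟨g, hg, hgb⟩ := F.exists_mem_eq_sup' hF (fun f => A f - v f / 2)
  have h₁ := F.le_sup' (fun f => A f + v f) hf
  have h₂ := F.le_sup' (fun f => A f + v f) hg
  have h₃ := F.le_sup' (fun f => A f - v f) hf
  have h₄ := F.le_sup' (fun f => A f - v f) hg
  rw [hfa, hgb]
  rcases le_total (v f) (v g) with h | h <;> linarith

/-- One-step admissibility of the relaxation for a fixed playout. -/
lemma loss_add_sup'_le {α : Type*} (F : Finset α) (hF : F.Nonempty) (A v : α → ℝ)
    {L : ℝ} (hL : 0 < L) (ℓ : ℝ → ℝ) (hlip : ∀ a b : ℝ, |ℓ a - ℓ b| ≤ L * |a - b|) :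
    ℓ (F.sup' hF (fun f => A f + v f / 2) - F.sup' hF (fun f => A f - v f / 2))
        + 2 * L * F.sup' hF (fun f => A f - 1 / (2 * L) * ℓ (v f))
      ≤ L * (F.sup' hF (fun f => A f + v f) + F.sup' hF (fun f => A f - v f)) := by
  refine le_trans ?_
    (mul_le_mul_of_nonneg_left (sup'_add_half_add_sup'_sub_half_le F hF A v) hL.le)
  obtain ⟨f, hf, hfe⟩ := F.exists_mem_eq_sup' hF (fun f => A f - 1 / (2 * L) * ℓ (v f))
  have ha := F.le_sup' (fun f => A f + v f / 2) hf
  have hb := F.le_sup' (fun f => A f - v f / 2) hf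
  rw [hfe]
  generalize F.sup' hF (fun f => A f + v f / 2) = a at *
  generalize F.sup' hF (fun f => A f - v f / 2) = b at *
  have h := (le_abs_self _).trans (hlip (a - b) (v f))
  have habs : |a - b - v f| ≤ a + b - 2 * A f := abs_le.2 ⟨by linarith, by linarith⟩
  have hmul := mul_le_mul_of_nonneg_left habs hL.le
  have hcancel : 2 * L * (A f - 1 / (2 * L) * ℓ (v f)) = 2 * L * A f - ℓ (v f) := by
    field_simp
  rw [hcancel]
  linarith

/-- Summing over the coordinates after `t` through the shifted index. -/
lemma sum_shift_eq_sum_ite {T t : ℕ} (g : Fin T → ℝ) :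
    ∑ j : Fin (T - (t + 1)), g ⟨t + 1 + j.val, by have := j.isLt; omega⟩
      = ∑ s : Fin T, if t < s.val then g s else 0 := by
  rw [← Finset.sum_filter]
  refine Finset.sum_bij (fun j _ => ⟨t + 1 + j.val, by have := j.isLt; omega⟩) ?_ ?_ ?_ ?_
  · intro j _
    simp only [Finset.mem_filter, Finset.mem_univ, true_and]
    omega
  · intro i _ j _ h
    simp only [Fin.mk.injEq] at h
    exact Fin.ext (by omega)
  · intro s hs
    simp only [Finset.mem_filter, Finset.mem_univ, true_and] at hs
    exact ⟨⟨s.val - (t + 1), by have := s.isLt; omega⟩, Finset.mem_univ _,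
      Fin.ext (by simp only; omega)⟩
  · intro j _
    rfl

/-- Averaging over one coordinate flip leaves the sum over sign patterns unchanged. -/
lemma sum_flip {n : ℕ} (t : Fin n) (G : (Fin n → Bool) → ℝ) :
    ∑ ε, G (Function.update ε t (!ε t)) = ∑ ε, G ε := by
  have hinv : Function.Involutive
      (fun ε : Fin n → Bool => Function.update ε t (!ε t)) := by
    intro ε
    simp
  exact Equiv.sum_comp hinv.toPerm G

/-- The value of a comparator `f` when the rounds before `t` are played and the others are
replaced by random signs. -/
noncomputable def playoutValue {T : ℕ} {Y : Type*} (L : ℝ) (ℓ : ℝ → Y → ℝ) (y : Fin T → Y)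
    (t : ℕ) (ε : Fin T → Bool) (f : Fin T → ℝ) : ℝ :=
  (∑ s : Fin T, if t ≤ s.val then (if ε s then (1 : ℝ) else -1) * f s else 0)
    - 1 / (2 * L) * ∑ s : Fin T, if s.val < t then ℓ (f s) (y s) else 0

/-- Splitting off the first term of a sum over the coordinates from `t` on. -/
lemma sum_ite_le_eq {T : ℕ} (g : Fin T → ℝ) (t : Fin T) :
    (∑ s : Fin T, if t.val ≤ s.val then g s else 0)
      = (∑ s : Fin T, if t.val < s.val then g s else 0) + g t := by
  rw [← Finset.sum_ite_eq' Finset.univ t g |>.trans (if_pos (Finset.mem_univ t)),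
    ← Finset.sum_add_distrib]
  refine Finset.sum_congr rfl fun s _ => ?_
  rcases lt_trichotomy t s with h | h | h
  · simp [h, h.le, h.ne']
  · simp [h]
  · simp [h.not_gt, h.not_ge, h.ne]

/-- Splitting off the last term of a sum over the coordinates up to `t`. -/
lemma sum_ite_lt_succ_eq {T : ℕ} (g : Fin T → ℝ) (t : Fin T) :
    (∑ s : Fin T, if s.val < t.val + 1 then g s else 0)
      = (∑ s : Fin T, if s.val < t.val then g s else 0) + g t := by
  rw [← Finset.sum_ite_eq' Finset.univ t g |>.trans (if_pos (Finset.mem_univ t)),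
    ← Finset.sum_add_distrib]
  refine Finset.sum_congr rfl fun s _ => ?_
  rcases lt_trichotomy t s with h | h | h
  · have : ¬ s.val < t.val + 1 := by have := Fin.lt_def.1 h; omega
    simp [this, h.not_gt, h.ne']
  · simp [h]
  · have : s.val < t.val + 1 := by have := Fin.lt_def.1 h; omega
    simp [this, h, h.ne]

/-- the random-playout forecaster for transductive online learning with
convex `L`-Lipschitz losses (Lemma 17): its expected regret is at most `2L` times the
classical Rademacher complexity of `F`. -/
theorem random_playout_transductive_regret
    (T : ℕ) (hT : 0 < T) (L : ℝ) (hL : 0 < L)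
    {Y : Type*} [Nonempty Y] (ℓ : ℝ → Y → ℝ)
    (hconv : ∀ y : Y, ConvexOn ℝ Set.univ (fun z : ℝ => ℓ z y))
    (hlip : ∀ (y : Y) (a b : ℝ), |ℓ a y - ℓ b y| ≤ L * |a - b|)
    (F : Finset (Fin T → ℝ)) (hF : F.Nonempty)
    (y : Fin T → Y)
    (yhat : (t : ℕ) → (Fin (T - (t + 1)) → Bool) → ℝ)
    (hyhat : ∀ t, ∀ (ht : t < T), ∀ ε : Fin (T - (t + 1)) → Bool, yhat t ε =
      F.sup' hF (fun f =>
          (∑ j : Fin (T - (t + 1)), (if ε j then (1 : ℝ) else -1) *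
              f ⟨t + 1 + j.val, by have := j.isLt; omega⟩)
            - (1 / (2 * L)) * (∑ s : Fin T, if s.val < t then ℓ (f s) (y s) else 0)
            + f ⟨t, ht⟩ / 2)
        - F.sup' hF (fun f =>
          (∑ j : Fin (T - (t + 1)), (if ε j then (1 : ℝ) else -1) *
              f ⟨t + 1 + j.val, by have := j.isLt; omega⟩)
            - (1 / (2 * L)) * (∑ s : Fin T, if s.val < t then ℓ (f s) (y s) else 0)
            - f ⟨t, ht⟩ / 2)) :
    (∑ t : Fin T, (2 : ℝ)⁻¹ ^ (T - (t.val + 1)) *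
        ∑ ε : Fin (T - (t.val + 1)) → Bool, ℓ (yhat t.val ε) (y t))
      - F.inf' hF (fun f => ∑ t : Fin T, ℓ (f t) (y t))
      ≤ 2 * L * ((2 : ℝ)⁻¹ ^ T *
          ∑ ε : Fin T → Bool,
            F.sup' hF (fun f => ∑ t : Fin T, (if ε t then (1 : ℝ) else -1) * f t)) := by
  have hstep : ∀ t : Fin T,
      (2 : ℝ)⁻¹ ^ (T - (t.val + 1)) *
          ∑ ε : Fin (T - (t.val + 1)) → Bool, ℓ (yhat t.val ε) (y t)
        ≤ 2 * L * ((2 : ℝ)⁻¹ ^ T * ∑ ε, F.sup' hF (playoutValue L ℓ y t.val ε))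
          - 2 * L * ((2 : ℝ)⁻¹ ^ T * ∑ ε, F.sup' hF (playoutValue L ℓ y (t.val + 1) ε)) := by
    intro t
    let e : Fin (T - (t.val + 1)) → Fin T :=
      fun j => ⟨t.val + 1 + j.val, by have := j.isLt; omega⟩
    have he : Function.Injective e := by
      intro i j h
      simp only [e, Fin.mk.injEq] at h
      exact Fin.ext (by omega)
    rw [average_comp_injective e he (fun ε => ℓ (yhat t.val ε) (y t))]
    have hpoint : ∀ ε : Fin T → Bool,
        ℓ (yhat t.val (ε ∘ e)) (y t) + 2 * L * F.sup' hF (playoutValue L ℓ y (t.val + 1) ε)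
          ≤ L * (F.sup' hF (playoutValue L ℓ y t.val ε)
            + F.sup' hF (playoutValue L ℓ y t.val (Function.update ε t (!ε t)))) := by
      intro ε
      let A : (Fin T → ℝ) → ℝ := fun f =>
        (∑ s : Fin T, if t.val < s.val then (if ε s then (1 : ℝ) else -1) * f s else 0)
          - 1 / (2 * L) * ∑ s : Fin T, if s.val < t.val then ℓ (f s) (y s) else 0
      have hpred : yhat t.val (ε ∘ e)
          = F.sup' hF (fun f => A f + f t / 2) - F.sup' hF (fun f => A f - f t / 2) := by
        rw [hyhat t.val t.isLt]
        have hA : ∀ f : Fin T → ℝ,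
            (∑ j : Fin (T - (t.val + 1)), (if (ε ∘ e) j then (1 : ℝ) else -1) *
              f ⟨t.val + 1 + j.val, by have := j.isLt; omega⟩)
            - (1 / (2 * L)) * (∑ s : Fin T, if s.val < t.val then ℓ (f s) (y s) else 0)
            = A f := fun f => congrArg (· - _)
              (sum_shift_eq_sum_ite fun s => (if ε s then (1 : ℝ) else -1) * f s)
        simp only [hA]
      have hnext : playoutValue L ℓ y (t.val + 1) ε
          = fun f => A f - 1 / (2 * L) * ℓ (f t) (y t) := by
        funext f
        simp only [playoutValue, A, Nat.succ_le_iff,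
          sum_ite_lt_succ_eq (fun s => ℓ (f s) (y s)) t]
        ring
      have hcur : playoutValue L ℓ y t.val ε
          = fun f => A f + (if ε t then (1 : ℝ) else -1) * f t := by
        funext f
        simp only [playoutValue, A,
          sum_ite_le_eq (fun s => (if ε s then (1 : ℝ) else -1) * f s) t]
        ring
      have hflip : playoutValue L ℓ y t.val (Function.update ε t (!ε t))
          = fun f => A f - (if ε t then (1 : ℝ) else -1) * f t := by
        funext f
        have hagree : (∑ s : Fin T, if t.val < s.val then
              (if Function.update ε t (!ε t) s then (1 : ℝ) else -1) * f s else 0)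
            = ∑ s : Fin T, if t.val < s.val then
              (if ε s then (1 : ℝ) else -1) * f s else 0 := by
          refine Finset.sum_congr rfl fun s _ => ?_
          by_cases h : t.val < s.val
          · rw [Function.update_of_ne (Fin.lt_def.2 h).ne']
          · rw [if_neg h, if_neg h]
        simp only [playoutValue, A, sum_ite_le_eq
          (fun s => (if Function.update ε t (!ε t) s then (1 : ℝ) else -1) * f s) t, hagree]
        cases h : ε t <;> simp <;> ring
      have hmain := loss_add_sup'_le F hF A (fun f => f t) hL (fun z => ℓ z (y t)) (hlip (y t))
      rw [hpred, hnext, hcur, hflip]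
      refine hmain.trans_eq ?_
      cases ε t
      · simp only [Bool.false_eq_true, if_false, neg_one_mul, sub_neg_eq_add, ← sub_eq_add_neg]
        rw [add_comm]
      · simp only [if_true, one_mul]
    have hsum := Finset.sum_le_sum fun ε (_ : ε ∈ Finset.univ) => hpoint ε
    rw [Finset.sum_add_distrib, ← Finset.mul_sum, ← Finset.mul_sum, Finset.sum_add_distrib,
      sum_flip t (fun ε => F.sup' hF (playoutValue L ℓ y t.val ε))] at hsum
    have hscaled := mul_le_mul_of_nonneg_left hsum (by positivity : (0 : ℝ) ≤ (2 : ℝ)⁻¹ ^ T)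
    linarith
  have htotal := Finset.sum_le_sum fun t (_ : t ∈ Finset.univ) => hstep t
  rw [Fin.sum_univ_eq_sum_range (fun t =>
      2 * L * ((2 : ℝ)⁻¹ ^ T * ∑ ε, F.sup' hF (playoutValue L ℓ y t ε))
        - 2 * L * ((2 : ℝ)⁻¹ ^ T * ∑ ε, F.sup' hF (playoutValue L ℓ y (t + 1) ε))),
    Finset.sum_range_sub'] at htotal
  have hzero : ∀ ε, playoutValue L ℓ y 0 ε
      = fun f => ∑ t : Fin T, (if ε t then (1 : ℝ) else -1) * f t := by
    intro ε
    funext f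
    simp [playoutValue]
  have hlast : -F.inf' hF (fun f => ∑ t : Fin T, ℓ (f t) (y t))
      ≤ 2 * L * ((2 : ℝ)⁻¹ ^ T * ∑ ε, F.sup' hF (playoutValue L ℓ y T ε)) := by
    obtain ⟨f, hf, hfe⟩ := F.exists_mem_eq_inf' hF (fun f => ∑ t : Fin T, ℓ (f t) (y t))
    have hle : ∀ ε, -(1 / (2 * L) * ∑ t : Fin T, ℓ (f t) (y t))
        ≤ F.sup' hF (playoutValue L ℓ y T ε) := by
      intro ε
      refine le_trans (le_of_eq ?_) (F.le_sup' (playoutValue L ℓ y T ε) hf)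
      simp [playoutValue, (Fin.is_lt _).not_ge]
    have hsum := Finset.sum_le_sum fun ε (_ : ε ∈ Finset.univ) => hle ε
    rw [Finset.sum_const, nsmul_eq_mul, Finset.card_univ, Fintype.card_fun, Fintype.card_bool,
      Fintype.card_fin] at hsum
    push_cast at hsum
    have hpow : (2 : ℝ)⁻¹ ^ T * 2 ^ T = 1 := by
      rw [← mul_pow]
      norm_num
    rw [hfe]
    refine le_trans (le_of_eq ?_) (mul_le_mul_of_nonneg_left (mul_le_mul_of_nonneg_left hsum
      (by positivity : (0 : ℝ) ≤ (2 : ℝ)⁻¹ ^ T)) (by positivity : 0 ≤ 2 * L))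
    rw [← mul_assoc ((2 : ℝ)⁻¹ ^ T), hpow]
    field_simp
  simp only [hzero] at htotal
  linarith
end
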